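/- arXiv:1611.01251 — 3 statements merged into one kernel-verified Lean document; each statement's English description precedes it below -/
import Mathlib

section
/- Let F be a field and k ≤ n positive integers. There exists an F-linear bijection L : S_{n,k} → F[OP_{n,k}] such that L(π̄_i(v)) = π̄_i(L(v)) for every 1 ≤ i ≤ n−1 and every v ∈ S_{n,k}, where on S_{n,k} the operator π̄_i is induced by the isobaric Demazure operator π_i minus the identity (well-defined since π_i preserves J_{n,k}), and on F[OP_{n,k}] the operator π̄_i is defined on an ordered set partition σ by: π̄_i(σ) = −σ if i+1 lies in a block strictly to the left of the block of i; π̄_i(σ) = 0 if i and i+1 lie in the same block; and π̄_i(σ) = s_i(σ) if i+1 lies in a block strictly to the right of the block of i, where s_i(σ) exchanges the letters i and i+1 in σ. In other words, S_{n,k} and F[OP_{n,k}] are isomorphic as modules over the 0-Hecke algebra H_n(0). -/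
open scoped Classical
open MvPolynomial

noncomputable section

namespace OSPHecke

/-- Stirling numbers of the second kind. -/
def stirling : ℕ → ℕ → ℕ
  | 0, 0 => 1
  | 0, _ + 1 => 0
  | _ + 1, 0 => 0
  | n + 1, k + 1 => stirling n k + (k + 1) * stirling n (k + 1)

/-- The `q`-analogue `[k]_q = 1 + q + ⋯ + q^{k-1}` as a polynomial in `q` over `ℕ`. -/
def qnat (k : ℕ) : Polynomial ℕ := ∑ t ∈ Finset.range k, Polynomial.X ^ t

/-- The `q`-factorial `[k]!_q`. -/
def qfact : ℕ → Polynomial ℕ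
  | 0 => 1
  | k + 1 => qnat (k + 1) * qfact k

/-- The `q`-Stirling numbers `Stir_q(n,k)`, defined by
`Stir_q(n,k) = Stir_q(n-1,k-1) + [k]_q · Stir_q(n-1,k)` and `Stir_q(0,k) = δ_{0,k}`. -/
def qstirling : ℕ → ℕ → Polynomial ℕ
  | 0, 0 => 1
  | 0, _ + 1 => 0
  | _ + 1, 0 => 0
  | n + 1, k + 1 => qstirling n k + qnat (k + 1) * qstirling n (k + 1)

variable (F : Type*) [Field F]

/-- The complete homogeneous symmetric polynomial of degree `d` in the first `m`
variables `x_1, …, x_m` of `F[x_1, …, x_n]` (variables are 0-indexed). -/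
def hpoly (n d m : ℕ) : MvPolynomial (Fin n) F :=
  ∑ s ∈ Finset.univ.filter (fun s : Sym (Fin n) d => ∀ j ∈ s.1, (j : ℕ) < m),
    (s.1.map MvPolynomial.X).prod

/-- The ideal `J_{n,k}` generated by `h_k(x_1), h_k(x_1,x_2), …, h_k(x_1,…,x_n)` and
`e_n(x_n), e_{n-1}(x_n), …, e_{n-k+1}(x_n)`. -/
def Jideal (n k : ℕ) : Ideal (MvPolynomial (Fin n) F) :=
  Ideal.span ({f | ∃ m, 1 ≤ m ∧ m ≤ n ∧ f = hpoly F n k m} ∪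
    {f | ∃ d, n - k < d ∧ d ≤ n ∧ f = MvPolynomial.esymm (Fin n) F d})

/-- The neglex order on exponent vectors: `a < b` iff there is a position `j` with
`a j < b j` and `a l = b l` for all `l > j`. -/
def NeglexLt {n : ℕ} (a b : Fin n → ℕ) : Prop :=
  ∃ j : Fin n, a j < b j ∧ ∀ l, j < l → a l = b l

/-- The value `w(t+1)` of a permutation at the 1-based position `t+1`
(0-based position `t`); extended by `0` outside the range. -/
def permVal {n : ℕ} (w : Equiv.Perm (Fin n)) (t : ℕ) : ℕ :=
  if h : t < n then (w ⟨t, h⟩ : ℕ) else 0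

/-- The descent set of a permutation, recorded 1-based:
`Des(w) = {j ∈ [n-1] : w(j) > w(j+1)}`. -/
def permDes {n : ℕ} (w : Equiv.Perm (Fin n)) : Finset ℕ :=
  (Finset.Ico 1 n).filter fun j => permVal w j < permVal w (j - 1)

/-- The inversion number (= Coxeter length) of a permutation. -/
def invCount {n : ℕ} (w : Equiv.Perm (Fin n)) : ℕ :=
  ((Finset.univ : Finset (Fin n × Fin n)).filter fun p => p.1 < p.2 ∧ w p.2 < w p.1).card

/-- The descent set (1-based) of a sequence `i = (i_1, i_2, …)`, given 0-based as
`i : ℕ → ℕ`: `Des(i) = {j ∈ [n-1] : i_j > i_{j+1}}`. -/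
def seqDes (n : ℕ) (i : ℕ → ℕ) : Finset ℕ :=
  (Finset.Ico 1 n).filter fun j => i j < i (j - 1)

/-- `α` is a composition of `n`. -/
def IsComposition (n : ℕ) (α : List ℕ) : Prop := α.sum = n ∧ ∀ a ∈ α, 0 < a

/-- The descent set of a composition: the partial sums `α_1, α_1+α_2, …`
excluding the total sum. -/
def desComp (α : List ℕ) : Finset ℕ :=
  ((Finset.range α.length).filter fun t => 0 < t).image fun t => (α.take t).sum

/-- The variable `x_{t+1}` (0-based index `t`), extended by `0` out of range. -/
def Xv (n : ℕ) (t : ℕ) : MvPolynomial (Fin n) F :=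
  if h : t < n then MvPolynomial.X ⟨t, h⟩ else 0

/-- The adjacent transposition exchanging the 0-based indices `t` and `t+1`. -/
def adjSwap (n t : ℕ) : Equiv.Perm (Fin n) :=
  if h : t + 1 < n then Equiv.swap ⟨t, Nat.lt_of_succ_lt h⟩ ⟨t + 1, h⟩ else 1

/-- `PibarRel F n t f g` says that `g = π̄_t(f)`, where (0-based indices `t`, `t+1`)
`π̄_t(f) = (x_{t+1}·(f - s_t(f)))/(x_t - x_{t+1}) = π_t(f) - f`; since `F[x]` is an
integral domain such a `g` is unique when it exists (and it always exists). -/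
def PibarRel (n t : ℕ) (f g : MvPolynomial (Fin n) F) : Prop :=
  (Xv F n t - Xv F n (t + 1)) * g =
    Xv F n (t + 1) * (f - MvPolynomial.rename (⇑(adjSwap n t)) f)

/-- The permutation associated to a word of (0-based) adjacent transposition indices. -/
def wordPerm (n : ℕ) (L : List ℕ) : Equiv.Perm (Fin n) := (L.map (adjSwap n)).prod

/-- `L` is a reduced word for `w`. -/
def IsReducedWord (n : ℕ) (L : List ℕ) (w : Equiv.Perm (Fin n)) : Prop :=
  (∀ t ∈ L, t + 1 < n) ∧ wordPerm n L = w ∧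
    ∀ L' : List ℕ, (∀ t ∈ L', t + 1 < n) → wordPerm n L' = w → L.length ≤ L'.length

/-- `g` is a chain of successive applications of the operators `π̄` along the word `L`,
applied right-to-left (so `g (t+1) = π̄_{L.reverse[t]} (g t)`). -/
def PibarChain (n : ℕ) (L : List ℕ) (g : ℕ → MvPolynomial (Fin n) F) : Prop :=
  ∀ t, t < L.length → PibarRel F n (L.reverse.getD t 0) (g t) (g (t + 1))

/-- `p = π̄_w(f)`, computed along some reduced word for `w`. -/
def IsPibarApplied (n : ℕ) (w : Equiv.Perm (Fin n)) (f p : MvPolynomial (Fin n) F) : Prop :=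
  ∃ (L : List ℕ) (g : ℕ → MvPolynomial (Fin n) F),
    IsReducedWord n L w ∧ g 0 = f ∧ PibarChain F n L g ∧ g L.length = p

/-- The monomial `x_{α,i} = (∏_{j ∈ Des(α)} x_1⋯x_j) · x_1^{i_1}⋯x_n^{i_n}`. -/
def xAI (n : ℕ) (α : List ℕ) (i : ℕ → ℕ) : MvPolynomial (Fin n) F :=
  (∏ j ∈ desComp α, ∏ t ∈ Finset.range j, Xv F n t) *
    ∏ t ∈ Finset.range n, Xv F n t ^ i t

/-- The defining conditions for the index set `A_{n,k}`: `α` is a composition of `n`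
with `α_1 > n-k`, and `k - ℓ(α) ≥ i_1 ≥ ⋯ ≥ i_{n-k} ≥ 0 = i_{n-k+1} = ⋯ = i_n`
(the sequence `i` is 0-indexed: `i t` is the paper's `i_{t+1}`). -/
def Acond (n k : ℕ) (α : List ℕ) (i : ℕ → ℕ) : Prop :=
  IsComposition n α ∧ n - k < α.headI ∧ i 0 + α.length ≤ k ∧
    (∀ a b, a ≤ b → b < n - k → i b ≤ i a) ∧ ∀ t, n - k ≤ t → i t = 0

/-- The exponent vector of the generalized Garsia–Stanton monomial `gs_{w,i}`:
the variable `x_{w(t)}` has exponent `#{d ∈ Des(w) : d ≥ t} + i_t` (1-based `t`). -/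
def gsExp {n : ℕ} (w : Equiv.Perm (Fin n)) (i : ℕ → ℕ) : Fin n → ℕ := fun m =>
  ((permDes w).filter fun r => (w.symm m : ℕ) + 1 ≤ r).card + i (w.symm m : ℕ)

/-- The generalized Garsia–Stanton monomial `gs_{w,i}`. -/
def gsMono (n : ℕ) (w : Equiv.Perm (Fin n)) (i : ℕ → ℕ) : MvPolynomial (Fin n) F :=
  ∏ m : Fin n, MvPolynomial.X m ^ gsExp w i m

/-- The condition `k - des(w) > i_1 ≥ ⋯ ≥ i_{n-k} ≥ 0 = i_{n-k+1} = ⋯ = i_n` defining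
membership of `gs_{w,i}` in `GS_{n,k}`. -/
def GScond (n k : ℕ) (w : Equiv.Perm (Fin n)) (i : ℕ → ℕ) : Prop :=
  i 0 + (permDes w).card < k ∧ (∀ a b, a ≤ b → b < n - k → i b ≤ i a) ∧
    ∀ t, n - k ≤ t → i t = 0

/-- An ordered set partition of `[n]` with `k` blocks: a `k`-tuple of nonempty,
pairwise disjoint subsets of `Fin n` covering `Fin n`. -/
def OSP (n k : ℕ) : Type :=
  {B : Fin k → Finset (Fin n) // (∀ j, (B j).Nonempty) ∧
    (∀ j l, j ≠ l → ∀ x, x ∈ B j → x ∉ B l) ∧ ∀ x, ∃ j, x ∈ B j}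

/-- Relabelling the letters of an ordered set partition by a permutation. -/
def ospMap {n k : ℕ} (e : Equiv.Perm (Fin n)) (σ : OSP n k) : OSP n k :=
  ⟨fun j => (σ.1 j).image e, by
    obtain ⟨h1, h2, h3⟩ := σ.2
    refine ⟨fun j => (h1 j).image e, fun j l hjl x hx hx' => ?_, fun x => ?_⟩
    · rcases Finset.mem_image.1 hx with ⟨y, hy, hey⟩
      rcases Finset.mem_image.1 hx' with ⟨y', hy', hey'⟩
      have : y = y' := e.injective (hey.trans hey'.symm)
      exact h2 j l hjl y hy (this ▸ hy')
    · rcases h3 (e.symm x) with ⟨j, hj⟩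
      exact ⟨j, Finset.mem_image.2 ⟨e.symm x, hj, e.apply_symm_apply x⟩⟩⟩

/-- `b` lies in a block strictly to the left of the block of `a`. -/
def leftOf {n k : ℕ} (σ : OSP n k) (a b : Fin n) : Prop :=
  ∃ p q : Fin k, p < q ∧ b ∈ σ.1 p ∧ a ∈ σ.1 q

/-- `a` and `b` lie in the same block. -/
def sameBlock {n k : ℕ} (σ : OSP n k) (a b : Fin n) : Prop :=
  ∃ p : Fin k, a ∈ σ.1 p ∧ b ∈ σ.1 p

/-- The value of the 0-Hecke generator `π` (for the pair of letters `a = i`,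
`b = i+1`) on a basis element of `F[OP_{n,k}]`. -/
def heckeImg {n k : ℕ} (a b : Fin n) (σ : OSP n k) : OSP n k →₀ F :=
  if leftOf σ a b then 0
  else if sameBlock σ a b then Finsupp.single σ 1
  else Finsupp.single σ 1 + Finsupp.single (ospMap (Equiv.swap a b) σ) 1

/-- The 0-Hecke operator `π` on `F[OP_{n,k}]` for the pair of letters `a = i`, `b = i+1`. -/
def heckeOp {n k : ℕ} (a b : Fin n) (f : OSP n k →₀ F) : OSP n k →₀ F :=
  f.sum fun σ c => c • heckeImg F a b σ

/-- The value of the 0-Hecke generator `π̄ = π - 1` on a basis element of `F[OP_{n,k}]`. -/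
def pibarImg {n k : ℕ} (a b : Fin n) (σ : OSP n k) : OSP n k →₀ F :=
  if leftOf σ a b then -Finsupp.single σ 1
  else if sameBlock σ a b then 0
  else Finsupp.single (ospMap (Equiv.swap a b) σ) 1

/-- The 0-Hecke operator `π̄ = π - 1` on `F[OP_{n,k}]`. -/
def pibarOp {n k : ℕ} (a b : Fin n) (f : OSP n k →₀ F) : OSP n k →₀ F :=
  f.sum fun σ c => c • pibarImg F a b σ

/-- `IsShuffle l₁ l₂ l` : `l` is an interleaving of `l₁` and `l₂` preserving the
relative order of the entries of each. -/
inductive IsShuffle : List ℕ → List ℕ → List ℕ → Prop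
  | nil : IsShuffle [] [] []
  | left {a l₁ l₂ l} : IsShuffle l₁ l₂ l → IsShuffle (a :: l₁) l₂ (a :: l)
  | right {a l₁ l₂ l} : IsShuffle l₁ l₂ l → IsShuffle l₁ (a :: l₂) (a :: l)

/-- An `(n,k)`-staircase: a shuffle of `(k-1, k-2, …, 1, 0)` with `n-k` copies of `k-1`. -/
def IsStaircase (n k : ℕ) (s : Fin n → ℕ) : Prop :=
  ∃ L : List ℕ, IsShuffle ((List.range k).reverse) (List.replicate (n - k) (k - 1)) L ∧
    ∀ j : Fin n, s j = L.getD (j : ℕ) 0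

/-- `B` is an ordered set partition of `[n]` (`n = α.sum`) of shape `α`. -/
def IsOSPShape (α : List ℕ) (B : Fin α.length → Finset (Fin α.sum)) : Prop :=
  (∀ j, (B j).card = α.get j) ∧
    (∀ j l, j ≠ l → ∀ x, x ∈ B j → x ∉ B l) ∧ ∀ x, ∃ j, x ∈ B j

/-- The ordered set partition `({1,…,α_1} | {α_1+1,…,α_1+α_2} | ⋯)` of shape `α`,
as a tuple of blocks. -/
def sigma0 (α : List ℕ) : Fin α.length → Finset (Fin α.sum) := fun j =>
  Finset.univ.filter fun x =>
    (α.take (j : ℕ)).sum ≤ (x : ℕ) ∧ (x : ℕ) < (α.take ((j : ℕ) + 1)).sum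

section Shape

variable {n ℓ : ℕ}

/-- `b` lies in a block strictly to the left of the block of `a` (tuples of blocks). -/
def blkLeft (B : Fin ℓ → Finset (Fin n)) (a b : Fin n) : Prop :=
  ∃ p q : Fin ℓ, p < q ∧ b ∈ B p ∧ a ∈ B q

/-- `a` and `b` lie in the same block (tuples of blocks). -/
def blkSame (B : Fin ℓ → Finset (Fin n)) (a b : Fin n) : Prop :=
  ∃ p : Fin ℓ, a ∈ B p ∧ b ∈ B p

/-- The value of the 0-Hecke generator `π` (for letters `a = i`, `b = i+1`) on a basis
element of the free module on tuples of blocks. -/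
def shapeImg (a b : Fin n) (B : Fin ℓ → Finset (Fin n)) :
    (Fin ℓ → Finset (Fin n)) →₀ F :=
  if blkLeft B a b then 0
  else if blkSame B a b then Finsupp.single B 1
  else Finsupp.single B 1 + Finsupp.single (fun j => (B j).image (Equiv.swap a b)) 1

/-- The 0-Hecke operator `π` on the free module on tuples of blocks. -/
def shapeOp (a b : Fin n) (f : (Fin ℓ → Finset (Fin n)) →₀ F) :
    (Fin ℓ → Finset (Fin n)) →₀ F :=
  f.sum fun B c => c • shapeImg F a b B

end Shape

/-- A `k`-tuple of blocks is an ordered set partition of `[n]` with `k` blocks. -/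
def IsOSPFun {n k : ℕ} (B : Fin k → Finset (Fin n)) : Prop :=
  (∀ j, (B j).Nonempty) ∧ (∀ j l, j ≠ l → ∀ x, x ∈ B j → x ∉ B l) ∧ ∀ x, ∃ j, x ∈ B j

/-- The `t`-th block (0-based) of a tuple of blocks, extended by `∅` out of range. -/
def blockExt {n k : ℕ} (B : Fin k → Finset (Fin n)) (t : ℕ) : Finset (Fin n) :=
  if h : t < k then B ⟨t, h⟩ else ∅

/-- The word (values in `{1, …, n}`) obtained by listing the elements of each block in
increasing order, reading the blocks from left to right. -/
def ospWord {n k : ℕ} (B : Fin k → Finset (Fin n)) : List ℕ :=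
  (List.finRange k).flatMap fun j => ((B j).sort (· ≤ ·)).map fun x => (x : ℕ) + 1

/-- The major index of a word: the sum of the (1-based) positions `j` with
`L_j > L_{j+1}`. -/
def wordMaj (L : List ℕ) : ℕ :=
  ∑ j ∈ Finset.range (L.length - 1), if L.getD (j + 1) 0 < L.getD j 0 then j + 1 else 0

/-- The major index of an ordered set partition `σ = (B_1 | ⋯ | B_k)`:
`maj(σ) = maj(w) + ∑_{i : max(B_i) < min(B_{i+1})} (α_1 + ⋯ + α_i - i)`. -/
def ospMaj {n k : ℕ} (B : Fin k → Finset (Fin n)) : ℕ :=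
  wordMaj (ospWord B) +
    ∑ t ∈ Finset.range (k - 1),
      if ∀ a ∈ blockExt B t, ∀ b ∈ blockExt B (t + 1), a < b then
        (∑ j ∈ Finset.range (t + 1), (blockExt B j).card) - (t + 1)
      else 0

/-- The complete homogeneous symmetric function of degree `d` evaluated at field
elements `v_1, …, v_n`. -/
def hval {n : ℕ} (v : Fin n → F) (d : ℕ) : F :=
  ∑ s ∈ (Finset.univ : Finset (Sym (Fin n) d)), (s.1.map v).prod

/-- The elementary symmetric function of degree `d` evaluated at field elements
`v_1, …, v_n` (it vanishes for `d > n`). -/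
def esymval {n : ℕ} (v : Fin n → F) (d : ℕ) : F :=
  ∑ t ∈ Finset.powersetCard d Finset.univ, ∏ j ∈ t, v j

end OSPHecke

namespace OSPHecke

section Demazure

variable {F : Type*} [Field F] {n : ℕ}

/-- The algebra automorphism of `F[x_1, …, x_n]` exchanging two variables. -/
def swapVar (i j : Fin n) : MvPolynomial (Fin n) F →ₐ[F] MvPolynomial (Fin n) F :=
  rename (Equiv.swap i j)

@[simp] lemma swapVar_X_left (i j : Fin n) : swapVar i j (X i : MvPolynomial (Fin n) F) = X j := by
  simp [swapVar]

@[simp] lemma swapVar_X_right (i j : Fin n) : swapVar i j (X j : MvPolynomial (Fin n) F) = X i := by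
  simp [swapVar]

lemma swapVar_X_of_ne {i j m : Fin n} (hi : m ≠ i) (hj : m ≠ j) :
    swapVar i j (X m : MvPolynomial (Fin n) F) = X m := by
  simp [swapVar, Equiv.swap_apply_of_ne_of_ne hi hj]

@[simp] lemma swapVar_swapVar (i j : Fin n) (f : MvPolynomial (Fin n) F) :
    swapVar i j (swapVar i j f) = f := by
  simp only [swapVar, rename_rename]
  convert rename_id_apply f
  ext x
  simp

lemma X_sub_X_ne_zero {i j : Fin n} (h : i ≠ j) : (X i - X j : MvPolynomial (Fin n) F) ≠ 0 :=
  sub_ne_zero.2 fun e => h (X_injective e)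

lemma exists_demazure (i j : Fin n) (f : MvPolynomial (Fin n) F) :
    ∃ g, (X i - X j) * g = X j * (f - swapVar i j f) := by
  suffices h : ∃ g, (X i - X j) * g = f - swapVar i j f by
    obtain ⟨g, hg⟩ := h
    exact ⟨X j * g, by rw [← hg]; ring⟩
  induction f using MvPolynomial.induction_on with
  | C a => exact ⟨0, by simp [swapVar]⟩
  | add p q hp hq =>
    obtain ⟨g, hg⟩ := hp
    obtain ⟨g', hg'⟩ := hq
    exact ⟨g + g', by rw [mul_add, hg, hg', map_add]; ring⟩
  | mul_X p m hp =>
    obtain ⟨g, hg⟩ := hp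
    have hX : ∃ u, (X i - X j) * u = (X m : MvPolynomial (Fin n) F) - swapVar i j (X m) := by
      by_cases h1 : m = i
      · subst h1
        exact ⟨1, by simp⟩
      by_cases h2 : m = j
      · subst h2
        exact ⟨-1, by simp⟩
      · exact ⟨0, by simp [swapVar_X_of_ne h1 h2]⟩
    obtain ⟨u, hu⟩ := hX
    refine ⟨g * X m + swapVar i j p * u, ?_⟩
    rw [map_mul]
    linear_combination X m * hg + swapVar i j p * hu

/-- The isobaric Demazure operator minus the identity, for an arbitrary pair of variables. -/
def demazure (i j : Fin n) : MvPolynomial (Fin n) F →ₗ[F] MvPolynomial (Fin n) F where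
  toFun f := if i = j then 0 else (exists_demazure i j f).choose
  map_add' f g := by
    split_ifs with h
    · simp
    · apply mul_left_cancel₀ (X_sub_X_ne_zero (F := F) h)
      rw [mul_add, (exists_demazure i j f).choose_spec, (exists_demazure i j g).choose_spec,
        (exists_demazure i j (f + g)).choose_spec, map_add]
      ring
  map_smul' c f := by
    split_ifs with h
    · simp
    · apply mul_left_cancel₀ (X_sub_X_ne_zero (F := F) h)
      rw [RingHom.id_apply, mul_smul_comm, (exists_demazure i j f).choose_spec,
        (exists_demazure i j (c • f)).choose_spec, map_smul, ← smul_sub, mul_smul_comm]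

lemma demazure_spec {i j : Fin n} (h : i ≠ j) (f : MvPolynomial (Fin n) F) :
    (X i - X j) * demazure i j f = X j * (f - swapVar i j f) := by
  simpa [demazure, h] using (exists_demazure i j f).choose_spec

lemma demazure_eq {i j : Fin n} (h : i ≠ j) {f g : MvPolynomial (Fin n) F}
    (hg : (X i - X j) * g = X j * (f - swapVar i j f)) : demazure i j f = g :=
  mul_left_cancel₀ (X_sub_X_ne_zero (F := F) h) ((demazure_spec h f).trans hg.symm)

lemma demazure_eq_zero {i j : Fin n} (h : i ≠ j) {f : MvPolynomial (Fin n) F}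
    (hf : swapVar i j f = f) : demazure i j f = 0 :=
  demazure_eq h (by simp [hf])

lemma demazure_mul {i j : Fin n} (h : i ≠ j) (f g : MvPolynomial (Fin n) F) :
    demazure i j (f * g) = demazure i j f * g + swapVar i j f * demazure i j g := by
  apply demazure_eq h
  rw [map_mul]
  linear_combination g * demazure_spec h f + swapVar i j f * demazure_spec h g

lemma demazure_demazure {i j : Fin n} (h : i ≠ j) (f : MvPolynomial (Fin n) F) :
    demazure i j (demazure i j f) = -demazure i j f := by
  apply demazure_eq h
  apply mul_left_cancel₀ (X_sub_X_ne_zero (F := F) h)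
  have h1 := demazure_spec h f
  have h2 := congrArg (swapVar i j) h1
  simp only [map_mul, map_sub, swapVar_X_left, swapVar_X_right, swapVar_swapVar] at h2
  linear_combination -X i * h1 - X j * h2

lemma demazure_comm {a b c d : Fin n} (hab : a ≠ b) (hcd : c ≠ d) (hac : a ≠ c) (had : a ≠ d)
    (hbc : b ≠ c) (hbd : b ≠ d) (f : MvPolynomial (Fin n) F) :
    demazure a b (demazure c d f) = demazure c d (demazure a b f) := by
  apply demazure_eq hab
  apply mul_left_cancel₀ (X_sub_X_ne_zero (F := F) hcd)
  have hs : swapVar a b (swapVar c d f) = swapVar c d (swapVar a b f) := by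
    simp only [swapVar, rename_rename]
    congr 2
    ext x
    have := Equiv.Perm.Disjoint.commute (f := Equiv.swap a b) (g := Equiv.swap c d) (by
      intro x
      by_cases h1 : x = a
      · right; rw [h1, Equiv.swap_apply_of_ne_of_ne hac had]
      by_cases h2 : x = b
      · right; rw [h2, Equiv.swap_apply_of_ne_of_ne hbc hbd]
      · left; rw [Equiv.swap_apply_of_ne_of_ne h1 h2])
    exact congrArg (fun e : Equiv.Perm (Fin n) => ((e x : Fin n) : ℕ)) this
  have e1 := demazure_spec hcd (demazure a b f)
  have e2 := congrArg (swapVar c d) (demazure_spec hab f)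
  have e3 := demazure_spec hab f
  have e4 := demazure_spec hcd f
  have e5 := congrArg (swapVar a b) e4
  simp only [map_mul, map_sub, swapVar_X_of_ne hac had, swapVar_X_of_ne hbc hbd,
    swapVar_X_of_ne hac.symm hbc.symm, swapVar_X_of_ne had.symm hbd.symm, hs] at e2 e5
  linear_combination (X a - X b) * e1 + X d * e3 - X d * e2 - X b * e4 + X b * e5

lemma demazure_braid {a b c : Fin n} (hab : a ≠ b) (hbc : b ≠ c) (hac : a ≠ c)
    (f : MvPolynomial (Fin n) F) :
    demazure a b (demazure b c (demazure a b f)) =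
      demazure b c (demazure a b (demazure b c f)) := by
  set g1 := demazure a b f with hg1
  set g2 := demazure b c g1 with hg2
  set h1 := demazure b c f with hh1
  set h2 := demazure a b h1 with hh2
  have hbraid : swapVar a b (swapVar b c (swapVar a b f)) =
      swapVar b c (swapVar a b (swapVar b c f)) := by
    simp only [swapVar, rename_rename]
    congr 2
    ext x
    simp only [Function.comp_apply, Equiv.swap_apply_def]
    split_ifs <;> simp_all
  have E1 := demazure_spec hab f
  have E2 := demazure_spec hbc g1
  have E3 := demazure_spec hab g2
  have H1 := demazure_spec hbc f
  have H2 := demazure_spec hab h1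
  have H3 := demazure_spec hbc h2
  rw [← hg1] at E1
  rw [← hg2] at E2
  rw [← hh1] at H1
  rw [← hh2] at H2
  have sE1 := congrArg (swapVar a b) E1
  have rE1 := congrArg (swapVar b c) E1
  have srE1 := congrArg (swapVar a b) rE1
  have sE2 := congrArg (swapVar a b) E2
  have rH1 := congrArg (swapVar b c) H1
  have sH1 := congrArg (swapVar a b) H1
  have rsH1 := congrArg (swapVar b c) sH1
  have rH2 := congrArg (swapVar b c) H2
  simp only [map_mul, map_sub, swapVar_X_left, swapVar_X_right, swapVar_swapVar,
    swapVar_X_of_ne hab hac, swapVar_X_of_ne hac.symm hbc.symm] at sE1 rE1 srE1 sE2 rH1 sH1 rsH1 rH2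
  have nab := X_sub_X_ne_zero (F := F) hab
  have nbc := X_sub_X_ne_zero (F := F) hbc
  have nac := X_sub_X_ne_zero (F := F) hac
  have G : ((X a - X b) * (X b - X c) * (X a - X c)) * demazure a b g2 = X b * X c ^ 2 *
      (f - swapVar a b f - swapVar b c f + swapVar b c (swapVar a b f)
        + swapVar a b (swapVar b c f) - swapVar a b (swapVar b c (swapVar a b f))) := by
    apply mul_left_cancel₀ nab
    linear_combination ((X a - X b) * (X b - X c) * (X a - X c)) * E3
      + X b * (X a - X c) * (X a - X b) * E2 - X b * (X a - X b) * (X b - X c) * sE2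
      + X b * X c * (X a - X c) * E1 - X b * X c * (X a - X b) * rE1
      + X b * X c * (X b - X c) * sE1 + X b * X c * (X a - X b) * srE1
  have H : ((X a - X b) * (X b - X c) * (X a - X c)) * demazure b c h2 = X b * X c ^ 2 *
      (f - swapVar a b f - swapVar b c f + swapVar b c (swapVar a b f)
        + swapVar a b (swapVar b c f) - swapVar a b (swapVar b c (swapVar a b f))) := by
    apply mul_left_cancel₀ nbc
    rw [hbraid]
    linear_combination ((X a - X b) * (X b - X c) * (X a - X c)) * H3
      + X c * (X a - X c) * (X b - X c) * H2 - X c * (X a - X b) * (X b - X c) * rH2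
      + X b * X c * (X a - X c) * H1 - X b * X c * (X b - X c) * sH1
      + X c ^ 2 * (X a - X b) * rH1 + X c ^ 2 * (X b - X c) * rsH1
  exact mul_left_cancel₀ (mul_ne_zero (mul_ne_zero nab nbc) nac) (G.trans H.symm)

end Demazure

section Monomials

variable (F : Type*) [Field F] {n : ℕ}

/-- The monomial with exponent vector `a`. -/
def mono (a : Fin n → ℕ) : MvPolynomial (Fin n) F := ∏ m, X m ^ a m

lemma mono_add (a b : Fin n → ℕ) : mono F (a + b) = mono F a * mono F b := by
  simp [mono, pow_add, Finset.prod_mul_distrib]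

lemma mono_eq_monomial (a : Fin n → ℕ) :
    mono F a = monomial (Finsupp.equivFunOnFinite.symm a) 1 := by
  rw [monomial_eq, C_1, one_mul, Finsupp.prod_fintype _ _ (by simp)]
  rfl

lemma monomial_eq_mono (s : Fin n →₀ ℕ) : (monomial s 1 : MvPolynomial (Fin n) F) = mono F s := by
  rw [mono_eq_monomial]
  congr
  ext
  simp

lemma swapVar_mono (i j : Fin n) (a : Fin n → ℕ) :
    swapVar i j (mono F a) = mono F (a ∘ Equiv.swap i j) := by
  simp only [mono, map_prod, map_pow, swapVar, rename_X, Function.comp_apply]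
  exact Fintype.prod_equiv (Equiv.swap i j) _ _ (by simp)

lemma mono_update_update {i j : Fin n} (h : i ≠ j) (a : Fin n → ℕ) (p q : ℕ) :
    mono F (Function.update (Function.update a i p) j q) =
      X i ^ p * X j ^ q * ∏ m ∈ (Finset.univ.erase i).erase j, X m ^ a m := by
  rw [mono, ← Finset.mul_prod_erase _ _ (Finset.mem_univ i),
    ← Finset.mul_prod_erase _ _ (Finset.mem_erase.2 ⟨h.symm, Finset.mem_univ j⟩), ← mul_assoc]
  congr 1
  · simp [h]
  · refine Finset.prod_congr rfl fun m hm => ?_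
    simp only [Finset.mem_erase] at hm
    simp [hm.1, hm.2.1]

lemma sum_update_update {i j : Fin n} (h : i ≠ j) (a : Fin n → ℕ) (p q : ℕ) (w : Fin n → ℕ → ℕ) :
    ∑ m, w m (Function.update (Function.update a i p) j q m) =
      w i p + w j q + ∑ m ∈ (Finset.univ.erase i).erase j, w m (a m) := by
  rw [← Finset.add_sum_erase _ _ (Finset.mem_univ i),
    ← Finset.add_sum_erase _ _ (Finset.mem_erase.2 ⟨h.symm, Finset.mem_univ j⟩), ← add_assoc]
  congr 1
  · simp [h]
  · refine Finset.sum_congr rfl fun m hm => ?_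
    simp only [Finset.mem_erase] at hm
    simp [hm.1, hm.2.1]

lemma comp_swap_eq_update {i j : Fin n} (a : Fin n → ℕ) :
    a ∘ Equiv.swap i j = Function.update (Function.update a i (a j)) j (a i) := by
  ext m
  by_cases h1 : m = j
  · subst h1; simp
  · by_cases h2 : m = i
    · subst h2; simp [h1]
    · simp [h1, h2, Equiv.swap_apply_of_ne_of_ne h2 h1]

lemma update_update_self (i j : Fin n) (a : Fin n → ℕ) :
    Function.update (Function.update a i (a i)) j (a j) = a := by simp

lemma demazure_mono {i j : Fin n} (h : i ≠ j) (a : Fin n → ℕ) (ha : a j ≤ a i) :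
    demazure i j (mono F a) = ∑ l ∈ Finset.range (a i - a j),
      mono F (Function.update (Function.update a i (a j + l)) j (a i - l)) := by
  apply demazure_eq h
  obtain ⟨r, hr⟩ := Nat.exists_eq_add_of_le ha
  have hself := mono_update_update F h a (a i) (a j)
  rw [update_update_self] at hself
  rw [swapVar_mono, comp_swap_eq_update, hself]
  simp only [mono_update_update F h, ← Finset.sum_mul]
  have key : ∑ l ∈ Finset.range (a i - a j), (X i ^ (a j + l) * X j ^ (a i - l) :
      MvPolynomial (Fin n) F) = (X i * X j) ^ (a j) * X j *
        ∑ l ∈ Finset.range r, X i ^ l * X j ^ (r - 1 - l) := by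
    rw [hr, Nat.add_sub_cancel_left, Finset.mul_sum]
    refine Finset.sum_congr rfl fun l hl => ?_
    rw [Finset.mem_range] at hl
    have : a j + r - l = a j + 1 + (r - 1 - l) := by omega
    rw [this]
    ring
  rw [key, hr]
  have := (Commute.all (X i : MvPolynomial (Fin n) F) (X j)).geom_sum₂_mul r
  linear_combination ((X i * X j) ^ (a j) * X j *
    ∏ m ∈ (Finset.univ.erase i).erase j, X m ^ a m) * this

/-- The span of the monomials of degree `D` whose sum of squared exponents is less than `q`. -/
def lowSpan (n D q : ℕ) : Submodule F (MvPolynomial (Fin n) F) :=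
  Submodule.span F {f | ∃ b : Fin n → ℕ, ∑ m, b m = D ∧ ∑ m, b m ^ 2 < q ∧ f = mono F b}

lemma mono_mem_lowSpan {b : Fin n → ℕ} {D q : ℕ} (hD : ∑ m, b m = D) (hq : ∑ m, b m ^ 2 < q) :
    mono F b ∈ lowSpan F n D q := Submodule.subset_span ⟨b, hD, hq, rfl⟩

lemma sum_comp_swap (i j : Fin n) (a : Fin n → ℕ) (w : ℕ → ℕ) :
    ∑ m, w ((a ∘ Equiv.swap i j) m) = ∑ m, w (a m) :=
  Fintype.sum_equiv (Equiv.swap i j) _ _ (by simp)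

lemma demazure_mono_sub_mem {i j : Fin n} (h : i ≠ j) (a : Fin n → ℕ) (ha : a j < a i) :
    demazure i j (mono F a) - mono F (a ∘ Equiv.swap i j) ∈
      lowSpan F n (∑ m, a m) (∑ m, a m ^ 2) := by
  obtain ⟨r, hr⟩ := Nat.exists_eq_add_of_lt ha
  rw [demazure_mono F h a ha.le, hr, show a j + r + 1 - a j = r + 1 by omega,
    Finset.sum_range_succ', comp_swap_eq_update, hr]
  simp only [add_zero, Nat.sub_zero, add_sub_cancel_right]
  refine Submodule.sum_mem _ fun l hl => mono_mem_lowSpan F ?_ ?_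
  · rw [Finset.mem_range] at hl
    conv_rhs => rw [← update_update_self i j a]
    rw [sum_update_update h a _ _ fun _ x => x, sum_update_update h a _ _ fun _ x => x]
    omega
  · rw [Finset.mem_range] at hl
    conv_rhs => rw [← update_update_self i j a]
    rw [sum_update_update h a _ _ fun _ x => x ^ 2, sum_update_update h a _ _ fun _ x => x ^ 2]
    rw [hr]
    obtain ⟨t, rfl⟩ := Nat.exists_eq_add_of_lt hl
    have : a j + (l + t + 1) + 1 - (l + 1) = a j + t + 1 := by omega
    rw [this]
    nlinarith

lemma demazure_mono_eq_zero {i j : Fin n} (h : i ≠ j) (a : Fin n → ℕ) (ha : a i = a j) :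
    demazure i j (mono F a) = 0 := by
  rw [demazure_mono F h a ha.ge, ha]
  simp

lemma demazure_mono_mem {i j : Fin n} (h : i ≠ j) (a : Fin n → ℕ) {D q : ℕ}
    (hD : ∑ m, a m = D) (hq : ∑ m, a m ^ 2 < q) : demazure i j (mono F a) ∈ lowSpan F n D q := by
  have main : ∀ b : Fin n → ℕ, b j < b i → ∑ m, b m = D → ∑ m, b m ^ 2 < q →
      demazure i j (mono F b) ∈ lowSpan F n D q := by
    intro b hb hbD hbq
    have h1 := demazure_mono_sub_mem F h b hb
    have h2 : lowSpan F n (∑ m, b m) (∑ m, b m ^ 2) ≤ lowSpan F n D q := by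
      apply Submodule.span_mono
      rintro f ⟨c, hc1, hc2, rfl⟩
      exact ⟨c, hc1.trans hbD, hc2.trans hbq, rfl⟩
    have h3 : mono F (b ∘ Equiv.swap i j) ∈ lowSpan F n D q :=
      mono_mem_lowSpan F ((sum_comp_swap i j b id).trans hbD)
        ((sum_comp_swap i j b (· ^ 2)).trans_lt hbq)
    simpa using add_mem (h2 h1) h3
  rcases lt_trichotomy (a i) (a j) with hlt | heq | hgt
  · have hs := main (a ∘ Equiv.swap i j) (by simpa using hlt)
      ((sum_comp_swap i j a id).trans hD) ((sum_comp_swap i j a (· ^ 2)).trans_lt hq)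
    have hz : demazure i j (mono F a + mono F (a ∘ Equiv.swap i j)) = 0 :=
      demazure_eq_zero h (by
        rw [map_add, swapVar_mono, swapVar_mono, add_comm]
        congr 2
        ext m
        simp)
    rw [map_add] at hz
    rw [eq_neg_of_add_eq_zero_left hz]
    exact neg_mem hs
  · rw [demazure_mono_eq_zero F h a heq]
    exact zero_mem _
  · exact main a hgt hD hq

lemma demazure_mem_lowSpan {i j : Fin n} (h : i ≠ j) {f : MvPolynomial (Fin n) F} {D q : ℕ}
    (hf : f ∈ lowSpan F n D q) : demazure i j f ∈ lowSpan F n D q := by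
  induction hf using Submodule.span_induction with
  | mem x hx =>
    obtain ⟨b, h1, h2, rfl⟩ := hx
    exact demazure_mono_mem F h b h1 h2
  | zero => simp
  | add x y _ _ hx hy => rw [map_add]; exact add_mem hx hy
  | smul c x _ hx => rw [map_smul]; exact Submodule.smul_mem _ _ hx

end Monomials

section Atoms

variable (F : Type*) [Field F] {n : ℕ}

/-- The sum of the exponents weighted by the positions. -/
def posWeight (a : Fin n → ℕ) : ℕ := ∑ m : Fin n, (m : ℕ) * a m

lemma posWeight_swap_lt {i j : Fin n} (hij : (j : ℕ) = i + 1) {a : Fin n → ℕ} (h : a i < a j) :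
    posWeight (a ∘ Equiv.swap i j) < posWeight a := by
  have hne : i ≠ j := fun e => by rw [e] at hij; omega
  unfold posWeight
  conv_rhs => rw [← update_update_self i j a]
  rw [comp_swap_eq_update, sum_update_update hne a _ _ fun m x => (m : ℕ) * x,
    sum_update_update hne a _ _ fun m x => (m : ℕ) * x, hij]
  nlinarith

/-- The Demazure atom: the image of a dominant monomial under a composition of operators
`demazure`, indexed by the exponent vector of its leading monomial. -/
def atom (a : Fin n → ℕ) : MvPolynomial (Fin n) F :=
  if h : ∃ p : Fin n × Fin n, (p.2 : ℕ) = p.1 + 1 ∧ a p.1 < a p.2 then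
    demazure h.choose.1 h.choose.2 (atom (a ∘ Equiv.swap h.choose.1 h.choose.2))
  else mono F a
termination_by posWeight a
decreasing_by exact posWeight_swap_lt h.choose_spec.1 h.choose_spec.2

lemma atom_of_dominant {a : Fin n → ℕ} (h : ∀ i j : Fin n, (j : ℕ) = i + 1 → a j ≤ a i) :
    atom F a = mono F a := by
  rw [atom, dif_neg]
  rintro ⟨p, h1, h2⟩
  exact absurd (h _ _ h1) (not_le.2 h2)

lemma comp_swap_comm {α : Type*} {i j k l : Fin n} (hik : i ≠ k) (hil : i ≠ l) (hjk : j ≠ k)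
    (hjl : j ≠ l) (a : Fin n → α) :
    (a ∘ Equiv.swap i j) ∘ Equiv.swap k l = (a ∘ Equiv.swap k l) ∘ Equiv.swap i j := by
  ext x
  simp only [Function.comp_apply, Equiv.swap_apply_def]
  split_ifs <;> simp_all

lemma comp_swap_braid {α : Type*} {i j k : Fin n} (hij : i ≠ j) (hjk : j ≠ k) (hik : i ≠ k)
    (a : Fin n → α) :
    ((a ∘ Equiv.swap i j) ∘ Equiv.swap j k) ∘ Equiv.swap i j =
      ((a ∘ Equiv.swap j k) ∘ Equiv.swap i j) ∘ Equiv.swap j k := by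
  ext x
  simp only [Function.comp_apply, Equiv.swap_apply_def]
  split_ifs <;> simp_all

lemma comp_swap_swap {α : Type*} (i j : Fin n) (a : Fin n → α) :
    (a ∘ Equiv.swap i j) ∘ Equiv.swap i j = a := by
  ext x
  simp

lemma atom_aux (a : Fin n → ℕ) :
    (∀ i j : Fin n, (j : ℕ) = i + 1 → a i < a j →
      atom F a = demazure i j (atom F (a ∘ Equiv.swap i j))) ∧
    (∀ i j : Fin n, (j : ℕ) = i + 1 → a i = a j → demazure i j (atom F a) = 0) := by
  induction hN : posWeight a using Nat.strong_induction_on generalizing a with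
  | _ N ih =>
  subst hN
  replace ih := fun b hb => ih (posWeight b) hb b rfl
  have conf : ∀ i j i' j' : Fin n, (j : ℕ) = i + 1 → (j' : ℕ) = i' + 1 → a i < a j → a i' < a j' →
      i < i' → demazure i j (atom F (a ∘ Equiv.swap i j)) =
        demazure i' j' (atom F (a ∘ Equiv.swap i' j')) := by
    intro i j i' j' hij hij' h h' hlt
    rw [Fin.lt_def] at hlt
    have nij : i ≠ j := fun e => by rw [e] at hij; omega
    have nij' : i' ≠ j' := fun e => by rw [e] at hij'; omega
    have l1 := posWeight_swap_lt hij h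
    have l2 := posWeight_swap_lt hij' h'
    by_cases hj : j = i'
    · subst hj
      have nil : i ≠ j' := fun e => by rw [e] at hij; omega
      have e1 := (ih _ l1).1 j j' hij' (by
        simp [Equiv.swap_apply_of_ne_of_ne nil.symm nij'.symm]; omega)
      have l3 := posWeight_swap_lt hij' (a := a ∘ Equiv.swap i j) (by
        simp [Equiv.swap_apply_of_ne_of_ne nil.symm nij'.symm]; omega)
      have e2 := (ih _ (l3.trans l1)).1 i j hij (by
        simp [Equiv.swap_apply_of_ne_of_ne nil.symm nij'.symm,
          Equiv.swap_apply_of_ne_of_ne nij nil]; omega)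
      have f1 := (ih _ l2).1 i j hij (by
        simp [Equiv.swap_apply_of_ne_of_ne nij nil]; omega)
      have l4 := posWeight_swap_lt hij (a := a ∘ Equiv.swap j j') (by
        simp [Equiv.swap_apply_of_ne_of_ne nij nil]; omega)
      have f2 := (ih _ (l4.trans l2)).1 j j' hij' (by
        simp [Equiv.swap_apply_of_ne_of_ne nil.symm nij'.symm,
          Equiv.swap_apply_of_ne_of_ne nij nil]; omega)
      rw [e1, e2, f1, f2, comp_swap_braid nij nij' nil, demazure_braid nij nij' nil]
    · have njj : (j : ℕ) ≠ i' := fun e => hj (Fin.ext e)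
      have n1 : i ≠ i' := fun e => by rw [e] at hlt; omega
      have n2 : i ≠ j' := fun e => by rw [e] at hlt; omega
      have n3 : j ≠ j' := fun e => by rw [e] at hij; omega
      have e1 := (ih _ l1).1 i' j' hij' (by
        simpa [Equiv.swap_apply_of_ne_of_ne n1.symm (Ne.symm hj),
          Equiv.swap_apply_of_ne_of_ne n2.symm n3.symm])
      have e2 := (ih _ l2).1 i j hij (by
        simpa [Equiv.swap_apply_of_ne_of_ne n1 n2, Equiv.swap_apply_of_ne_of_ne hj n3])
      rw [e1, e2, comp_swap_comm n1 n2 hj n3, demazure_comm nij nij' n1 n2 hj n3]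
  have conf' : ∀ i j i' j' : Fin n, (j : ℕ) = i + 1 → (j' : ℕ) = i' + 1 → a i < a j → a i' < a j' →
      demazure i j (atom F (a ∘ Equiv.swap i j)) =
        demazure i' j' (atom F (a ∘ Equiv.swap i' j')) := by
    intro i j i' j' hij hij' h h'
    rcases lt_trichotomy i i' with hlt | heq | hgt
    · exact conf i j i' j' hij hij' h h' hlt
    · subst heq
      obtain rfl : j = j' := Fin.ext (by omega)
      rfl
    · exact (conf i' j' i j hij' hij h' h hgt).symm
  have key : ∀ i j : Fin n, (j : ℕ) = i + 1 → a i < a j →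
      atom F a = demazure i j (atom F (a ∘ Equiv.swap i j)) := by
    intro i j hij h
    have hex : ∃ p : Fin n × Fin n, (p.2 : ℕ) = p.1 + 1 ∧ a p.1 < a p.2 := ⟨(i, j), hij, h⟩
    rw [atom, dif_pos hex]
    exact conf' _ _ _ _ hex.choose_spec.1 hij hex.choose_spec.2 h
  refine ⟨key, fun i j hij h => ?_⟩
  have nij : i ≠ j := fun e => by rw [e] at hij; omega
  by_cases hex : ∃ p : Fin n × Fin n, (p.2 : ℕ) = p.1 + 1 ∧ a p.1 < a p.2
  · obtain ⟨⟨p, q⟩, hpq, hlt⟩ := hex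
    simp only at hpq hlt
    have npq : p ≠ q := fun e => by rw [e] at hpq; omega
    have l1 := posWeight_swap_lt hpq hlt
    rw [key p q hpq hlt]
    by_cases h1 : p = j
    · subst h1
      have niq : i ≠ q := fun e => by rw [e] at hij; omega
      have l3 := posWeight_swap_lt hij (a := a ∘ Equiv.swap p q) (by
        simp [Equiv.swap_apply_of_ne_of_ne nij niq]; omega)
      have e1 := (ih _ l1).1 i p hij (by
        simp [Equiv.swap_apply_of_ne_of_ne nij niq]; omega)
      have e2 := (ih _ (l3.trans l1)).2 p q hpq (by
        simp [Equiv.swap_apply_of_ne_of_ne niq.symm npq.symm,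
          Equiv.swap_apply_of_ne_of_ne nij niq, h])
      rw [e1, demazure_braid nij npq niq, e2, map_zero, map_zero]
    by_cases h2 : q = i
    · subst h2
      have npj : p ≠ j := fun e => h1 e
      have l3 := posWeight_swap_lt hij (a := a ∘ Equiv.swap p q) (by
        simp [Equiv.swap_apply_of_ne_of_ne npj.symm nij.symm]; omega)
      have e1 := (ih _ l1).1 q j hij (by
        simp [Equiv.swap_apply_of_ne_of_ne npj.symm nij.symm]; omega)
      have e2 := (ih _ (l3.trans l1)).2 p q hpq (by
        simp [Equiv.swap_apply_of_ne_of_ne npj.symm nij.symm,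
          Equiv.swap_apply_of_ne_of_ne npq npj, h])
      rw [e1, ← demazure_braid npq nij npj, e2, map_zero, map_zero]
    by_cases h3 : p = i
    · subst h3
      obtain rfl : q = j := Fin.ext (by omega)
      omega
    · have h4 : q ≠ j := fun e => h3 (Fin.ext (by rw [e] at hpq; omega))
      rw [demazure_comm nij npq (Ne.symm h3) (Ne.symm h2) (Ne.symm h1) h4.symm,
        (ih _ l1).2 i j hij, map_zero]
      simpa [Equiv.swap_apply_of_ne_of_ne (Ne.symm h3) (Ne.symm h2),
        Equiv.swap_apply_of_ne_of_ne (Ne.symm h1) h4.symm]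
  · rw [atom, dif_neg hex]
    exact demazure_mono_eq_zero F nij a h

lemma atom_of_lt {i j : Fin n} (hij : (j : ℕ) = i + 1) {a : Fin n → ℕ} (h : a i < a j) :
    atom F a = demazure i j (atom F (a ∘ Equiv.swap i j)) := (atom_aux F a).1 i j hij h

lemma demazure_atom_of_eq {i j : Fin n} (hij : (j : ℕ) = i + 1) {a : Fin n → ℕ} (h : a i = a j) :
    demazure i j (atom F a) = 0 := (atom_aux F a).2 i j hij h

lemma demazure_atom_of_gt {i j : Fin n} (hij : (j : ℕ) = i + 1) {a : Fin n → ℕ} (h : a j < a i) :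
    demazure i j (atom F a) = atom F (a ∘ Equiv.swap i j) := by
  rw [atom_of_lt F hij (a := a ∘ Equiv.swap i j) (by simpa), comp_swap_swap]

/-- Induction on the position weight: a property which holds for dominant exponent vectors and
is preserved by passing from a descent to an ascent holds for all exponent vectors. -/
lemma ascent_induction {P : (Fin n → ℕ) → Prop}
    (h0 : ∀ a : Fin n → ℕ, (∀ i j : Fin n, (j : ℕ) = i + 1 → a j ≤ a i) → P a)
    (h1 : ∀ (a : Fin n → ℕ) (i j : Fin n), (j : ℕ) = i + 1 → a i < a j →
      P (a ∘ Equiv.swap i j) → P a) (a : Fin n → ℕ) : P a := by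
  induction hN : posWeight a using Nat.strong_induction_on generalizing a with
  | _ N ih =>
  subst hN
  by_cases hex : ∃ p : Fin n × Fin n, (p.2 : ℕ) = p.1 + 1 ∧ a p.1 < a p.2
  · obtain ⟨⟨i, j⟩, hij, hlt⟩ := hex
    exact h1 a i j hij hlt (ih _ (posWeight_swap_lt hij hlt) _ rfl)
  · push Not at hex
    exact h0 a fun i j hij => hex (i, j) hij

lemma atom_sub_mono_mem (a : Fin n → ℕ) :
    atom F a - mono F a ∈ lowSpan F n (∑ m, a m) (∑ m, a m ^ 2) := by
  induction a using ascent_induction with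
  | h0 a h =>
    rw [atom_of_dominant F h, sub_self]
    exact zero_mem _
  | h1 a i j hij h ih =>
    have nij : i ≠ j := fun e => by rw [e] at hij; omega
    have e := demazure_mono_sub_mem F nij (a ∘ Equiv.swap i j) (by simpa)
    have e' := demazure_mem_lowSpan F nij ih
    rw [atom_of_lt F hij h]
    rw [comp_swap_swap] at e
    rw [map_sub] at e'
    have := add_mem e' e
    rw [show ∑ m, (a ∘ Equiv.swap i j) m = ∑ m, a m from sum_comp_swap i j a id,
      show ∑ m, (a ∘ Equiv.swap i j) m ^ 2 = ∑ m, a m ^ 2 from sum_comp_swap i j a (· ^ 2)] at this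
    simpa using this

end Atoms

section Stability

variable (F : Type*) [Field F] {n : ℕ}

lemma hpoly_zero_left (m : ℕ) : hpoly F n 0 m = 1 := by
  rw [hpoly, Finset.sum_eq_single Sym.nil]
  · exact Multiset.prod_zero
  · intro b _ hb
    exact absurd (Subsingleton.elim b Sym.nil) hb
  · intro h
    exact absurd (Finset.mem_filter.2 ⟨Finset.mem_univ _, fun j hj => by simp at hj⟩) h

lemma hpoly_succ_zero (d : ℕ) : hpoly F n (d + 1) 0 = 0 := by
  rw [hpoly, Finset.sum_eq_zero]
  intro s hs
  obtain ⟨a, ha⟩ := s.exists_mem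
  simp only [Finset.mem_filter] at hs
  exact absurd (hs.2 a ha) (Nat.not_lt_zero _)

lemma hpoly_succ_succ (d : ℕ) (m : Fin n) :
    hpoly F n (d + 1) (m + 1) = hpoly F n (d + 1) m + X m * hpoly F n d (m + 1) := by
  have h1 : Finset.univ.filter (fun s : Sym (Fin n) (d + 1) => ∀ j ∈ s.1, (j : ℕ) < m + 1) =
      Finset.univ.filter (fun s : Sym (Fin n) (d + 1) => ∀ j ∈ s.1, (j : ℕ) < m) ∪
      (Finset.univ.filter (fun s : Sym (Fin n) d => ∀ j ∈ s.1, (j : ℕ) < m + 1)).image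
        (fun s => m ::ₛ s) := by
    ext s
    simp only [Finset.mem_filter, Finset.mem_univ, true_and, Finset.mem_union, Finset.mem_image]
    constructor
    · intro h
      by_cases hm : m ∈ s
      · refine Or.inr ⟨s.erase m hm, fun j hj => h j ?_, Sym.cons_erase hm⟩
        exact Multiset.mem_of_mem_erase hj
      · refine Or.inl fun j hj => lt_of_le_of_ne (Nat.lt_succ_iff.1 (h j hj)) fun e => hm ?_
        rw [← Fin.ext e]
        exact hj
    · rintro (h | ⟨s', h, rfl⟩) j hj
      · exact (h j hj).trans (Nat.lt_succ_self _)
      · rcases Multiset.mem_cons.1 hj with rfl | hj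
        · exact Nat.lt_succ_self _
        · exact h j hj
  rw [hpoly, h1, Finset.sum_union, Finset.sum_image]
  · congr 1
    rw [hpoly, Finset.mul_sum]
    refine Finset.sum_congr rfl fun s _ => ?_
    simp [Sym.cons]
  · exact fun s _ s' _ h => Sym.cons_inj_right _ _ _ |>.1 h
  · rw [Finset.disjoint_left]
    intro s hs hs'
    obtain ⟨s', _, rfl⟩ := Finset.mem_image.1 hs'
    exact absurd ((Finset.mem_filter.1 hs).2 m (Multiset.mem_cons_self _ _)) (lt_irrefl _)

lemma swapVar_hpoly {i j : Fin n} {m : ℕ} (h : (i : ℕ) < m ↔ (j : ℕ) < m) (d : ℕ) :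
    swapVar i j (hpoly F n d m) = hpoly F n d m := by
  have hm : ∀ (s : Sym (Fin n) d), (∀ x ∈ s.1, (x : ℕ) < m) →
      ∀ x ∈ (s.map (Equiv.swap i j)).1, (x : ℕ) < m := by
    intro s hs x hx
    obtain ⟨y, hy, rfl⟩ := Multiset.mem_map.1 hx
    have := hs y hy
    rw [Equiv.swap_apply_def]
    split_ifs with h1 h2
    · rw [← h, ← h1]; exact this
    · rw [h, ← h2]; exact this
    · exact this
  have inv : ∀ s : Sym (Fin n) d, (s.map (Equiv.swap i j)).map (Equiv.swap i j) = s := by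
    intro s
    rw [Sym.map_map]
    convert Sym.map_id s
    simp
  rw [hpoly, map_sum]
  refine Finset.sum_nbij' (fun s => s.map (Equiv.swap i j)) (fun s => s.map (Equiv.swap i j))
    ?_ ?_ ?_ ?_ ?_
  · intro s hs
    exact Finset.mem_filter.2 ⟨Finset.mem_univ _, hm s (Finset.mem_filter.1 hs).2⟩
  · intro s hs
    exact Finset.mem_filter.2 ⟨Finset.mem_univ _, hm s (Finset.mem_filter.1 hs).2⟩
  · exact fun s _ => inv s
  · exact fun s _ => inv s
  · intro s _
    rw [map_multiset_prod, Multiset.map_map]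
    change _ = (Multiset.map _ (Multiset.map _ s.1)).prod
    rw [Multiset.map_map]
    congr 1
    refine Multiset.map_congr rfl fun x _ => ?_
    simp [swapVar]

lemma hpoly_one (d : ℕ) (h : 0 < n) : hpoly F n d 1 = X ⟨0, h⟩ ^ d := by
  induction d with
  | zero => rw [hpoly_zero_left, pow_zero]
  | succ d ih =>
    have := hpoly_succ_succ F d (⟨0, h⟩ : Fin n)
    simp only [zero_add] at this
    rw [this, hpoly_succ_zero, ih, zero_add, pow_succ']

lemma hpoly_mem {k m : ℕ} (h1 : 1 ≤ m) (hm : m ≤ n) : hpoly F n k m ∈ Jideal F n k :=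
  Ideal.subset_span (Or.inl ⟨m, h1, hm, rfl⟩)

lemma esymm_mem {k d : ℕ} (h1 : n - k < d) (hd : d ≤ n) : esymm (Fin n) F d ∈ Jideal F n k :=
  Ideal.subset_span (Or.inr ⟨d, h1, hd, rfl⟩)

lemma demazure_hpoly {i j : Fin n} (hij : (j : ℕ) = i + 1) (d : ℕ) :
    demazure i j (hpoly F n (d + 1) (i + 1)) =
      hpoly F n (d + 1) (j + 1) - hpoly F n (d + 1) (i + 1) := by
  have nij : i ≠ j := fun e => by rw [e] at hij; omega
  have h1 := hpoly_succ_succ F d j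
  have h2 := swapVar_hpoly F (i := i) (j := j) (m := j + 1) (by omega) (d + 1)
  have h3 := swapVar_hpoly F (i := i) (j := j) (m := j + 1) (by omega) d
  have h4 := congrArg (swapVar i j) h1
  rw [map_add, map_mul, h2, h3, swapVar_X_right] at h4
  rw [hij] at *
  apply demazure_eq nij
  linear_combination (X i - X j) * h1 - X j * h4 + X j * h1

lemma demazure_mem_Jideal {k : ℕ} (hk : 1 ≤ k) {i j : Fin n} (hij : (j : ℕ) = i + 1)
    {f : MvPolynomial (Fin n) F} (hf : f ∈ Jideal F n k) :
    demazure i j f ∈ Jideal F n k := by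
  have nij : i ≠ j := fun e => by rw [e] at hij; omega
  induction hf using Submodule.span_induction with
  | mem x hx =>
    rcases hx with ⟨m, h1, hm, rfl⟩ | ⟨d, h1, hd, rfl⟩
    · by_cases him : m = i + 1
      · obtain ⟨d, rfl⟩ := Nat.exists_eq_add_of_le' hk
        rw [him, demazure_hpoly F hij]
        exact sub_mem (hpoly_mem F (by omega) (by omega)) (hpoly_mem F (by omega) (by omega))
      · rw [demazure_eq_zero nij (swapVar_hpoly F (by omega) _)]
        exact zero_mem _
    · rw [demazure_eq_zero nij (esymm_isSymmetric _ _ _ _)]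
      exact zero_mem _
  | zero => rw [map_zero]; exact zero_mem _
  | add x y _ _ hx hy => rw [map_add]; exact add_mem hx hy
  | smul a x hx hx' =>
    rw [smul_eq_mul, demazure_mul nij]
    exact add_mem (Ideal.mul_mem_left _ _ hx) (Ideal.mul_mem_left _ _ hx')

end Stability

section WordPoly

variable (F : Type*) [Field F] {n : ℕ}

/-- The number of letters of the word `w` which are smaller than `v`. -/
def countBelow (w : Fin n → ℕ) (v : ℕ) : ℕ := (Finset.univ.filter fun i => w i < v).card

/-- The block indices `v` with `0 < v < k` having more than `n - k` letters to their left. -/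
def lateSet (k : ℕ) (w : Fin n → ℕ) : Finset ℕ :=
  (Finset.Ico 1 k).filter fun v => n - k < countBelow w v

/-- The threshold of `v`: it is `v` itself, lowered by `countBelow w v - (n - k)` if `v ∈ G`. -/
def threshold (k : ℕ) (w : Fin n → ℕ) (G : Finset ℕ) (v : ℕ) : ℕ :=
  if v ∈ G then v - (countBelow w v - (n - k)) else v

/-- The exponent attached to the block index `x`: the number of thresholds exceeding `x`. -/
def blockExp (k : ℕ) (w : Fin n → ℕ) (G : Finset ℕ) (x : ℕ) : ℕ :=
  ((Finset.Ico 1 k).filter fun v => x < threshold k w G v).card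

/-- The word `w` has an inversion between two letters with the same image under `c`. -/
def HasFlatInversion (c : ℕ → ℕ) (w : Fin n → ℕ) : Prop :=
  ∃ p q : Fin n, p < q ∧ w q < w p ∧ c (w p) = c (w q)

/-- The contribution of `G` to `wordPoly`: an atom, or zero if letters get identified in the
wrong order. -/
def wordAtom (k : ℕ) (w : Fin n → ℕ) (G : Finset ℕ) : MvPolynomial (Fin n) F :=
  if HasFlatInversion (blockExp k w G) w then 0 else atom F fun i => blockExp k w G (w i)

/-- The polynomial representing the ordered set partition with word `w`. -/
def wordPoly (k : ℕ) (w : Fin n → ℕ) : MvPolynomial (Fin n) F :=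
  ∑ G ∈ (lateSet k w).powerset, wordAtom F k w G

lemma countBelow_comp_swap (i j : Fin n) (w : Fin n → ℕ) :
    countBelow (w ∘ Equiv.swap i j) = countBelow w := by
  ext v
  unfold countBelow
  refine Finset.card_bij' (fun x _ => Equiv.swap i j x) (fun x _ => Equiv.swap i j x) ?_ ?_ ?_ ?_
  · simp
  · simp
  · simp
  · simp

lemma lateSet_comp_swap (k : ℕ) (i j : Fin n) (w : Fin n → ℕ) :
    lateSet k (w ∘ Equiv.swap i j) = lateSet k w := by
  unfold lateSet
  rw [countBelow_comp_swap]

lemma blockExp_comp_swap (k : ℕ) (i j : Fin n) (w : Fin n → ℕ) :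
    blockExp k (w ∘ Equiv.swap i j) = blockExp k w := by
  unfold blockExp threshold
  rw [countBelow_comp_swap]

lemma blockExp_antitone (k : ℕ) (w : Fin n → ℕ) (G : Finset ℕ) : Antitone (blockExp k w G) := by
  intro x y h
  refine Finset.card_le_card fun v hv => ?_
  rw [Finset.mem_filter] at hv ⊢
  exact ⟨hv.1, h.trans_lt hv.2⟩

lemma HasFlatInversion.comp_swap {c : ℕ → ℕ} {w : Fin n → ℕ} {i j : Fin n}
    (hij : (j : ℕ) = i + 1) (hc : c (w i) ≠ c (w j)) (h : HasFlatInversion c w) :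
    HasFlatInversion c (w ∘ Equiv.swap i j) := by
  obtain ⟨p, q, hpq, h1, h2⟩ := h
  refine ⟨Equiv.swap i j p, Equiv.swap i j q, ?_, by simpa, by simpa⟩
  have : ¬ (p = i ∧ q = j) := by
    rintro ⟨rfl, rfl⟩
    exact hc h2
  rw [Equiv.swap_apply_def, Equiv.swap_apply_def]
  simp only [Fin.lt_def, Fin.ext_iff] at *
  split_ifs <;> omega

lemma hasFlatInversion_comp_swap_iff {c : ℕ → ℕ} {w : Fin n → ℕ} {i j : Fin n}
    (hij : (j : ℕ) = i + 1) (hc : c (w i) ≠ c (w j)) :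
    HasFlatInversion c (w ∘ Equiv.swap i j) ↔ HasFlatInversion c w := by
  refine ⟨fun h => ?_, fun h => h.comp_swap hij hc⟩
  rw [← comp_swap_swap i j w]
  exact h.comp_swap hij (by simpa using hc.symm)

lemma demazure_wordAtom_of_eq (k : ℕ) {w : Fin n → ℕ} (G : Finset ℕ) {i j : Fin n}
    (hij : (j : ℕ) = i + 1) (h : blockExp k w G (w i) = blockExp k w G (w j)) :
    demazure i j (wordAtom F k w G) = 0 := by
  unfold wordAtom
  split_ifs
  · rw [map_zero]
  · exact demazure_atom_of_eq F hij h

lemma demazure_wordAtom_of_lt (k : ℕ) {w : Fin n → ℕ} (G : Finset ℕ) {i j : Fin n}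
    (hij : (j : ℕ) = i + 1) (h : w i < w j) :
    demazure i j (wordAtom F k w G) = wordAtom F k (w ∘ Equiv.swap i j) G := by
  by_cases hc : blockExp k w G (w i) = blockExp k w G (w j)
  · rw [demazure_wordAtom_of_eq F k G hij hc, wordAtom, if_pos]
    refine ⟨i, j, Fin.lt_def.2 (by omega), by simpa, ?_⟩
    rw [blockExp_comp_swap]
    simpa using hc.symm
  · unfold wordAtom
    rw [blockExp_comp_swap]
    simp only [hasFlatInversion_comp_swap_iff hij hc]
    split_ifs
    · rw [map_zero]
    · rw [demazure_atom_of_gt F hij]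
      · rfl
      · exact lt_of_le_of_ne (blockExp_antitone k w G h.le) (Ne.symm hc)

lemma demazure_wordPoly_of_eq (k : ℕ) {w : Fin n → ℕ} {i j : Fin n}
    (hij : (j : ℕ) = i + 1) (h : w i = w j) : demazure i j (wordPoly F k w) = 0 := by
  rw [wordPoly, map_sum]
  exact Finset.sum_eq_zero fun G _ => demazure_wordAtom_of_eq F k G hij (by rw [h])

lemma demazure_wordPoly_of_lt (k : ℕ) {w : Fin n → ℕ} {i j : Fin n}
    (hij : (j : ℕ) = i + 1) (h : w i < w j) :
    demazure i j (wordPoly F k w) = wordPoly F k (w ∘ Equiv.swap i j) := by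
  rw [wordPoly, map_sum, wordPoly, lateSet_comp_swap]
  exact Finset.sum_congr rfl fun G _ => demazure_wordAtom_of_lt F k G hij h

lemma demazure_wordPoly_of_gt (k : ℕ) {w : Fin n → ℕ} {i j : Fin n}
    (hij : (j : ℕ) = i + 1) (h : w j < w i) :
    demazure i j (wordPoly F k w) = -wordPoly F k w := by
  have e := demazure_wordPoly_of_lt F k (w := w ∘ Equiv.swap i j) hij (by simpa)
  rw [comp_swap_swap] at e
  rw [← e, demazure_demazure]
  exact fun e => by rw [e] at hij; omega

end WordPoly

section Reductions

variable (F : Type*) [Field F] {n : ℕ}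

lemma posWeight_le (a : Fin n → ℕ) : posWeight a ≤ n * ∑ m, a m := by
  rw [posWeight, Finset.mul_sum]
  exact Finset.sum_le_sum fun m _ => Nat.mul_le_mul_right _ m.2.le

/-- Induction on exponent vectors: by decreasing degree (relative to the bound `D`), then by the
sum of squares, then by decreasing position weight. -/
lemma exponent_induction {P : (Fin n → ℕ) → Prop} (D : ℕ)
    (h : ∀ b : Fin n → ℕ, (∀ c, D - ∑ m, c m < D - ∑ m, b m → P c) →
      (∀ c, ∑ m, c m = ∑ m, b m → ∑ m, c m ^ 2 < ∑ m, b m ^ 2 → P c) →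
      (∀ c, ∑ m, c m = ∑ m, b m → ∑ m, c m ^ 2 = ∑ m, b m ^ 2 → posWeight b < posWeight c → P c) →
      P b) (b : Fin n → ℕ) : P b := by
  let μ : (Fin n → ℕ) → ℕ ×ₗ ℕ ×ₗ ℕ := fun b =>
    toLex (D - ∑ m, b m, toLex (∑ m, b m ^ 2, n * ∑ m, b m - posWeight b))
  induction b using (InvImage.wf μ wellFounded_lt).induction with
  | _ b ih =>
  have ih' : ∀ c, μ c < μ b → P c := ih
  simp only [μ, Prod.Lex.toLex_lt_toLex] at ih'
  refine h b (fun c hc => ih' c (Or.inl hc)) (fun c h1 h2 => ih' c (Or.inr ⟨by rw [h1], Or.inl h2⟩))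
    fun c h1 h2 h3 => ih' c (Or.inr ⟨by rw [h1], Or.inr ⟨h2, ?_⟩⟩)
  have := posWeight_le c
  simp only [h1] at this ⊢
  omega

lemma antitone_of_adjacent {a : Fin n → ℕ} (h : ∀ i j : Fin n, (j : ℕ) = i + 1 → a j ≤ a i)
    {i j : Fin n} (hij : i ≤ j) : a j ≤ a i := by
  obtain ⟨j, hj⟩ := j
  induction j with
  | zero => rw [show i = ⟨0, hj⟩ from Fin.ext (by rw [Fin.le_def] at hij; simpa using hij)]
  | succ j ih =>
    by_cases e : i = ⟨j + 1, hj⟩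
    · rw [e]
    · refine (h ⟨j, by omega⟩ _ rfl).trans (ih _ ?_)
      simp only [Fin.le_def, Fin.ext_iff] at *
      omega

lemma atom_mem_Jideal {k : ℕ} (hk : 1 ≤ k) (a : Fin n → ℕ) (h : ∃ i, k ≤ a i) :
    atom F a ∈ Jideal F n k := by
  induction a using ascent_induction with
  | h0 a ha =>
    obtain ⟨i, hi⟩ := h
    have hn : 0 < n := i.pos
    rw [atom_of_dominant F ha]
    have h1 : k ≤ a ⟨0, hn⟩ := hi.trans (antitone_of_adjacent ha (Fin.le_def.2 (Nat.zero_le _)))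
    have h2 := hpoly_mem F (k := k) le_rfl hn
    rw [hpoly_one F k hn] at h2
    refine Ideal.mem_of_dvd _ ((pow_dvd_pow _ h1).trans ?_) h2
    exact Finset.dvd_prod_of_mem (fun m => X m ^ a m) (Finset.mem_univ _)
  | h1 a i j hij hlt ih =>
    obtain ⟨p, hp⟩ := h
    rw [atom_of_lt F hij hlt]
    exact demazure_mem_Jideal F hk hij (ih ⟨Equiv.swap i j p, by simpa⟩)

lemma sum_lt_sum_of_card_eq {ι : Type*} {S T : Finset ι} {f : ι → ℕ} (hc : S.card = T.card)
    (hS : S.Nonempty) (h : ∀ s ∈ S, ∀ t ∈ T, f s < f t) : ∑ s ∈ S, f s < ∑ t ∈ T, f t := by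
  obtain ⟨M, hM, hmax⟩ := Finset.exists_max_image S f hS
  have h1 : ∑ s ∈ S, f s ≤ S.card * f M := by
    simpa using Finset.sum_le_card_nsmul S f _ hmax
  have h2 : T.card * (f M + 1) ≤ ∑ t ∈ T, f t := by
    simpa using Finset.card_nsmul_le_sum T f _ fun t ht => h M hM t ht
  have := Finset.card_pos.2 hS
  rw [← hc] at h2
  nlinarith

lemma mono_mul_esymm (a : Fin n → ℕ) (d : ℕ) :
    mono F a * esymm (Fin n) F d = ∑ A ∈ Finset.powersetCard d Finset.univ,
      mono F (fun i => a i + if i ∈ A then 1 else 0) := by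
  rw [esymm, Finset.mul_sum]
  refine Finset.sum_congr rfl fun A _ => ?_
  simp only [mono, pow_add, Finset.prod_mul_distrib]
  simp [pow_ite, Finset.prod_ite_mem]

/-- Straightening with an elementary symmetric polynomial. -/
lemma mono_mem_of_column {k : ℕ} {U : Submodule F (MvPolynomial (Fin n) F)}
    (hU : ∀ f ∈ Jideal F n k, f ∈ U) {b : Fin n → ℕ} {v : ℕ} (hv : 1 ≤ v)
    (hcard : n - k < (Finset.univ.filter fun i => v ≤ b i).card)
    (hpos : ∀ p q, b p = v → b q + 1 = v → p < q)
    (h1 : ∀ c : Fin n → ℕ, ∑ m, c m = ∑ m, b m → ∑ m, c m ^ 2 < ∑ m, b m ^ 2 → mono F c ∈ U)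
    (h2 : ∀ c : Fin n → ℕ, ∑ m, c m = ∑ m, b m → ∑ m, c m ^ 2 = ∑ m, b m ^ 2 →
      posWeight b < posWeight c → mono F c ∈ U) : mono F b ∈ U := by
  set A₀ := Finset.univ.filter fun i => v ≤ b i with hA₀
  have mem₀ : ∀ i, i ∈ A₀ ↔ v ≤ b i := fun i => by simp [hA₀]
  let a : Fin n → ℕ := fun i => b i - if i ∈ A₀ then 1 else 0
  have hab : (fun i => a i + if i ∈ A₀ then 1 else 0) = b := by
    ext i
    simp only [a, mem₀]
    split_ifs <;> omega
  have hJ : mono F a * esymm (Fin n) F A₀.card ∈ U :=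
    hU _ (Ideal.mul_mem_left _ _ (esymm_mem F hcard (by simpa using Finset.card_le_univ A₀)))
  rw [mono_mul_esymm, ← Finset.add_sum_erase _ _
    (Finset.mem_powersetCard.2 ⟨Finset.subset_univ A₀, rfl⟩), hab] at hJ
  refine (U.add_mem_iff_left (Submodule.sum_mem _ fun A hA => ?_)).1 hJ
  rw [Finset.mem_erase, Finset.mem_powersetCard] at hA
  obtain ⟨hne, -, hAc⟩ := hA
  have lin : ∀ (w : Fin n → ℕ) (B : Finset (Fin n)),
      ∑ m, w m * (a m + if m ∈ B then 1 else 0) = ∑ m, w m * a m + ∑ m ∈ B, w m := by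
    intro w B
    simp [mul_add, Finset.sum_add_distrib]
  have sq : ∀ B : Finset (Fin n),
      ∑ m, (a m + if m ∈ B then 1 else 0) ^ 2 = ∑ m, a m ^ 2 + 2 * ∑ m ∈ B, a m + B.card := by
    intro B
    have : ∀ m, (a m + if m ∈ B then 1 else 0) ^ 2 =
        a m ^ 2 + (if m ∈ B then 2 * a m else 0) + if m ∈ B then 1 else 0 := by
      intro m
      split_ifs <;> ring
    simp [this, Finset.sum_add_distrib, Finset.mul_sum]
  have split : ∀ f : Fin n → ℕ, ∑ m ∈ A, f m + ∑ m ∈ A₀ \ A, f m =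
      ∑ m ∈ A₀, f m + ∑ m ∈ A \ A₀, f m := by
    intro f
    rw [← Finset.sum_union Finset.disjoint_sdiff, ← Finset.sum_union Finset.disjoint_sdiff,
      Finset.union_sdiff_self_eq_union, Finset.union_sdiff_self_eq_union, Finset.union_comm]
  have hc : (A₀ \ A).card = (A \ A₀).card := by
    have := split 1
    simp at this
    omega
  have hne' : (A₀ \ A).Nonempty := by
    rw [Finset.sdiff_nonempty]
    exact fun hs => hne (Finset.eq_of_subset_of_card_le hs hAc.le).symm
  have lo : ∀ m ∈ A₀ \ A, v - 1 ≤ a m := by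
    intro m hm
    have := (mem₀ m).1 (Finset.mem_sdiff.1 hm).1
    simp only [a, mem₀]
    split_ifs; omega
  have hi : ∀ m ∈ A \ A₀, a m ≤ v - 1 := by
    intro m hm
    have := mt (mem₀ m).2 (Finset.mem_sdiff.1 hm).2
    simp only [a, mem₀]
    split_ifs; omega
  have lo' : (A₀ \ A).card * (v - 1) ≤ ∑ m ∈ A₀ \ A, a m := by
    simpa using Finset.card_nsmul_le_sum _ _ _ lo
  have hi' : ∑ m ∈ A \ A₀, a m ≤ (A \ A₀).card * (v - 1) := by
    simpa using Finset.sum_le_card_nsmul _ _ _ hi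
  have deg : ∑ m, (a m + if m ∈ A then 1 else 0) = ∑ m, b m := by
    have e1 := lin 1 A
    have e2 := lin 1 A₀
    simp only [Pi.one_apply, one_mul] at e1 e2
    rw [e1, ← hab, e2]
    simpa using hAc
  have sqb : ∑ m, b m ^ 2 = ∑ m, a m ^ 2 + 2 * ∑ m ∈ A₀, a m + A₀.card := by
    rw [← sq, ← hab]
  have spl := split a
  rw [hc] at lo'
  rcases (show ∑ m ∈ A, a m ≤ ∑ m ∈ A₀, a m by omega).lt_or_eq with hlt | heq
  · exact h1 _ deg (by rw [sq, sqb]; omega)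
  · refine h2 _ deg (by rw [sq, sqb]; omega) ?_
    have q1 : ∑ m ∈ A₀ \ A, a m = ∑ _m ∈ A₀ \ A, (v - 1) := by
      rw [Finset.sum_const, hc, smul_eq_mul]; omega
    have q2 : ∑ m ∈ A \ A₀, a m = ∑ _m ∈ A \ A₀, (v - 1) := by
      rw [Finset.sum_const, smul_eq_mul]; omega
    have q1' := (Finset.sum_eq_sum_iff_of_le lo).1 q1.symm
    have q2' := (Finset.sum_eq_sum_iff_of_le hi).1 q2
    have w1 := lin (fun m => (m : ℕ)) A
    have w2 := lin (fun m => (m : ℕ)) A₀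
    have e : ∀ m, (a m + if m ∈ A₀ then 1 else 0) = b m := fun m => congrFun hab m
    simp only [e] at w2
    rw [posWeight, posWeight, w1, w2]
    have := sum_lt_sum_of_card_eq (f := fun m : Fin n => (m : ℕ)) hc hne' (by
      intro s hs t ht
      have s1 := (mem₀ s).1 (Finset.mem_sdiff.1 hs).1
      have t1 := mt (mem₀ t).2 (Finset.mem_sdiff.1 ht).2
      have s2 := q1' s hs
      have t2 := q2' t ht
      have es := e s
      have et := e t
      rw [if_pos (Finset.mem_sdiff.1 hs).1] at es
      rw [if_neg (Finset.mem_sdiff.1 ht).2] at et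
      exact Fin.lt_def.1 (hpos s t (by omega) (by omega)))
    have := split fun m : Fin n => (m : ℕ)
    omega

end Reductions

section Ranks

variable {n : ℕ}

/-- The rank of the position `i` when sorting the entries of `b` decreasingly, with ties broken
from left to right. -/
def sortRank (b : Fin n → ℕ) (i : Fin n) : ℕ :=
  (Finset.univ.filter fun j => b i < b j ∨ b j = b i ∧ j < i).card

/-- The number of entries of `b` which are at least `v`. -/
def countGe (b : Fin n → ℕ) (v : ℕ) : ℕ := (Finset.univ.filter fun i => v ≤ b i).card

/-- The entry of rank `t` in the decreasing rearrangement of `b` (whose entries are smaller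
than `k`), and zero for `n ≤ t`. -/
def sortedVal (k : ℕ) (b : Fin n → ℕ) (t : ℕ) : ℕ :=
  ((Finset.Ico 1 k).filter fun v => t < countGe b v).card

lemma sortRank_lt (b : Fin n → ℕ) (i : Fin n) : sortRank b i < n := by
  have h : sortRank b i < (Finset.univ : Finset (Fin n)).card := by
    refine Finset.card_lt_card ⟨Finset.subset_univ _, fun h => ?_⟩
    simpa using h (Finset.mem_univ i)
  simpa using h

lemma sortRank_lt_of_lt {b : Fin n → ℕ} {i j : Fin n} (h : b j < b i ∨ b i = b j ∧ i < j) :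
    sortRank b i < sortRank b j := by
  refine Finset.card_lt_card ⟨fun x hx => ?_, fun hs => ?_⟩
  · simp only [Finset.mem_filter, Finset.mem_univ, true_and] at hx ⊢
    omega
  · have := @hs i (by simpa using h)
    simp at this

lemma sortRank_lt_iff {b : Fin n → ℕ} {i j : Fin n} :
    sortRank b i < sortRank b j ↔ b j < b i ∨ b i = b j ∧ i < j := by
  refine ⟨fun h => ?_, sortRank_lt_of_lt⟩
  by_contra hc
  by_cases e : i = j
  · rw [e] at h; omega
  · have := sortRank_lt_of_lt (b := b) (i := j) (j := i) (by omega)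
    omega

lemma sortRank_injective (b : Fin n → ℕ) : Function.Injective (sortRank b) := by
  intro i j h
  by_contra hne
  rcases lt_or_ge (b i) (b j) with h1 | h1
  · exact absurd (sortRank_lt_of_lt (Or.inl h1)) (by omega)
  rcases h1.lt_or_eq with h1 | h1
  · exact absurd (sortRank_lt_of_lt (Or.inl h1)) (by omega)
  rcases lt_or_gt_of_ne hne with h2 | h2
  · exact absurd (sortRank_lt_of_lt (Or.inr ⟨h1.symm, h2⟩)) (by omega)
  · exact absurd (sortRank_lt_of_lt (Or.inr ⟨h1, h2⟩)) (by omega)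

lemma image_sortRank (b : Fin n → ℕ) : Finset.univ.image (sortRank b) = Finset.range n := by
  apply Finset.eq_of_subset_of_card_le
  · intro t ht
    obtain ⟨i, -, rfl⟩ := Finset.mem_image.1 ht
    exact Finset.mem_range.2 (sortRank_lt b i)
  · rw [Finset.card_image_of_injective _ (sortRank_injective b)]
    simp

lemma exists_sortRank (b : Fin n → ℕ) {t : ℕ} (ht : t < n) : ∃ i, sortRank b i = t := by
  have := image_sortRank b ▸ Finset.mem_range.2 ht
  simpa using this

lemma card_sortRank_lt (b : Fin n → ℕ) {T : ℕ} (hT : T ≤ n) :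
    (Finset.univ.filter fun i => sortRank b i < T).card = T := by
  rw [← Finset.card_image_of_injective _ (sortRank_injective b)]
  refine Eq.trans (congrArg Finset.card ?_) (Finset.card_range T)
  ext t
  simp only [Finset.mem_image, Finset.mem_filter, Finset.mem_univ, true_and, Finset.mem_range]
  constructor
  · rintro ⟨i, hi, rfl⟩
    exact hi
  · intro ht
    obtain ⟨i, hi⟩ := exists_sortRank b (ht.trans_le hT)
    exact ⟨i, hi ▸ ht, hi⟩

lemma sortRank_lt_countGe_iff {b : Fin n → ℕ} {i : Fin n} {v : ℕ} :
    sortRank b i < countGe b v ↔ v ≤ b i := by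
  constructor
  · intro h
    by_contra hc
    refine absurd (Finset.card_le_card fun x hx => ?_) (not_le.2 h)
    simp only [Finset.mem_filter, Finset.mem_univ, true_and] at hx ⊢
    omega
  · intro h
    refine Finset.card_lt_card ⟨fun x hx => ?_, fun hs => ?_⟩
    · simp only [Finset.mem_filter, Finset.mem_univ, true_and] at hx ⊢
      omega
    · have := @hs i (by simpa using h)
      simp at this

variable {k : ℕ} {b : Fin n → ℕ}

lemma countGe_le_of_le {u v : ℕ} (h : u ≤ v) : countGe b v ≤ countGe b u := by
  refine Finset.card_le_card fun x hx => ?_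
  simp only [Finset.mem_filter, Finset.mem_univ, true_and] at hx ⊢
  omega

lemma sortedVal_antitone : Antitone (sortedVal k b) := by
  intro t u h
  refine Finset.card_le_card fun v hv => ?_
  rw [Finset.mem_filter] at hv ⊢
  exact ⟨hv.1, h.trans_lt hv.2⟩

lemma sortedVal_sortRank (hb : ∀ i, b i < k) (i : Fin n) : sortedVal k b (sortRank b i) = b i := by
  simp only [sortedVal, sortRank_lt_countGe_iff]
  have : (Finset.Ico 1 k).filter (fun v => v ≤ b i) = Finset.Icc 1 (b i) := by
    ext v
    have := hb i
    simp only [Finset.mem_filter, Finset.mem_Ico, Finset.mem_Icc]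
    omega
  simp [this]

lemma le_sortedVal_iff {v t : ℕ} (h1 : 1 ≤ v) (h2 : v < k) :
    v ≤ sortedVal k b t ↔ t < countGe b v := by
  constructor
  · intro h
    by_contra hc
    have : (Finset.Ico 1 k).filter (fun v => t < countGe b v) ⊆ Finset.Ico 1 v := by
      intro u hu
      simp only [Finset.mem_filter, Finset.mem_Ico] at hu ⊢
      refine ⟨hu.1.1, ?_⟩
      by_contra huv
      have := countGe_le_of_le (b := b) (not_lt.1 huv)
      omega
    have := Finset.card_le_card this
    rw [Nat.card_Ico] at this
    unfold sortedVal at h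
    omega
  · intro h
    have : Finset.Icc 1 v ⊆ (Finset.Ico 1 k).filter (fun v => t < countGe b v) := by
      intro u hu
      simp only [Finset.mem_filter, Finset.mem_Ico, Finset.mem_Icc] at hu ⊢
      exact ⟨by omega, h.trans_le (countGe_le_of_le hu.2)⟩
    simpa [sortedVal] using Finset.card_le_card this

lemma sortedVal_lt (hk : 1 ≤ k) (t : ℕ) : sortedVal k b t < k := by
  have := Finset.card_filter_le (Finset.Ico 1 k) (fun v => t < countGe b v)
  rw [Nat.card_Ico] at this
  unfold sortedVal
  omega

/-- The number of distinct entries of `b` exceeding `x`. -/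
def gapCount (b : Fin n → ℕ) (x : ℕ) : ℕ := ((Finset.univ.image b).filter fun w => x < w).card

lemma gapCount_antitone : Antitone (gapCount b) := by
  intro x y h
  refine Finset.card_le_card fun v hv => ?_
  rw [Finset.mem_filter] at hv ⊢
  exact ⟨hv.1, h.trans_lt hv.2⟩

lemma gapCount_lt {x y : ℕ} (h : x < y) (hy : y ∈ Finset.univ.image b) :
    gapCount b y < gapCount b x := by
  refine Finset.card_lt_card ⟨fun v hv => ?_, fun hs => ?_⟩
  · rw [Finset.mem_filter] at hv ⊢
    exact ⟨hv.1, h.trans hv.2⟩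
  · have := @hs y (Finset.mem_filter.2 ⟨hy, h⟩)
    simp at this

lemma gapCount_eq_add {x y : ℕ} (h : x ≤ y) : gapCount b x = gapCount b y +
    ((Finset.univ.image b).filter fun w => x < w ∧ w ≤ y).card := by
  rw [gapCount, gapCount, ← Finset.card_union_of_disjoint]
  · congr 1
    ext w
    simp only [Finset.mem_filter, Finset.mem_union]
    rcases lt_or_ge y w with h' | h' <;> simp [h', h.trans_lt]
  · rw [Finset.disjoint_filter]
    intro w _ h1 h2
    omega

lemma gapCount_succ (x : ℕ) :
    gapCount b x = gapCount b (x + 1) + if x + 1 ∈ Finset.univ.image b then 1 else 0 := by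
  rw [gapCount_eq_add (Nat.le_succ x)]
  congr 1
  have : ((Finset.univ.image b).filter fun w => x < w ∧ w ≤ x + 1) =
      if x + 1 ∈ Finset.univ.image b then {x + 1} else ∅ := by
    ext w
    split_ifs with h <;> simp only [Finset.mem_filter, Finset.mem_singleton, Finset.notMem_empty]
    · constructor
      · rintro ⟨_, h1, h2⟩; omega
      · rintro rfl; exact ⟨h, by omega, le_rfl⟩
    · constructor
      · rintro ⟨h0, h1, h2⟩
        exact h ((show w = x + 1 by omega) ▸ h0)
      · exact False.elim
  rw [show x.succ = x + 1 from rfl, this]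
  split_ifs <;> simp

end Ranks

section RankWord

variable {n : ℕ}

/-- The block index of the letter of rank `t`, in the word attached to the exponent vector `b`. -/
def rankWord (k : ℕ) (b : Fin n → ℕ) (t : ℕ) : ℕ :=
  (t - (n - k)) + gapCount b (sortedVal k b t + (t - (n - k)))

/-- The exponent vectors which are not reducible: all entries are smaller than `k`, and every
long column has an ascent. -/
structure IsReduced (k : ℕ) (b : Fin n → ℕ) : Prop where
  one_le : 1 ≤ k
  le : k ≤ n
  lt : ∀ i, b i < k
  exists_ascent : ∀ v, 1 ≤ v → n - k < countGe b v → ∃ q p, q < p ∧ b p = v ∧ b q + 1 = v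

namespace IsReduced

variable {k : ℕ} {b : Fin n → ℕ} (h : IsReduced k b)
include h

lemma exists_rank {t : ℕ} (ht : n - k ≤ t) (h1 : 1 ≤ sortedVal k b t) :
    ∃ q, b q + 1 = sortedVal k b t ∧ t < sortRank b q := by
  have hlt := sortedVal_lt (b := b) h.one_le t
  have := (le_sortedVal_iff h1 hlt).1 le_rfl
  obtain ⟨q, p, -, -, hq⟩ := h.exists_ascent _ h1 (ht.trans_lt this)
  refine ⟨q, hq, ?_⟩
  by_contra hc
  have := sortedVal_antitone (k := k) (b := b) (not_lt.1 hc)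
  rw [sortedVal_sortRank h.lt] at this
  omega

lemma sortedVal_le_succ {t : ℕ} (ht : n - k ≤ t) :
    sortedVal k b t ≤ sortedVal k b (t + 1) + 1 := by
  rcases Nat.eq_zero_or_pos (sortedVal k b t) with h0 | h1
  · omega
  · obtain ⟨q, hq, hlt⟩ := h.exists_rank ht h1
    have := sortedVal_antitone (k := k) (b := b) (Nat.succ_le_of_lt hlt)
    rw [sortedVal_sortRank h.lt] at this
    simp only [Nat.succ_eq_add_one] at this
    omega

lemma sortedVal_last {t : ℕ} (ht : n - 1 ≤ t) : sortedVal k b t = 0 := by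
  have := h.one_le
  have := h.le
  by_contra h0
  obtain ⟨q, -, hlt⟩ := h.exists_rank (t := t) (by omega) (by omega)
  have := sortRank_lt b q
  omega

lemma sortedVal_mem_image {t : ℕ} (ht : t < n) : sortedVal k b t ∈ Finset.univ.image b := by
  obtain ⟨i, rfl⟩ := exists_sortRank b ht
  rw [sortedVal_sortRank h.lt]
  exact Finset.mem_image_of_mem _ (Finset.mem_univ _)

lemma potential_mono {t u : ℕ} (ht : n - k ≤ t) (htu : t ≤ u) :
    sortedVal k b t + (t - (n - k)) ≤ sortedVal k b u + (u - (n - k)) := by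
  induction u, htu using Nat.le_induction with
  | base => exact le_rfl
  | succ u hu ih =>
    have := h.sortedVal_le_succ (ht.trans hu)
    omega

lemma rankWord_of_last {t : ℕ} (ht : n - 1 ≤ t) : rankWord k b t = t - (n - k) := by
  have h1 := h.one_le
  have h2 := h.le
  rw [rankWord, h.sortedVal_last ht, gapCount, Finset.filter_false_of_mem]
  · simp
  · intro w hw
    obtain ⟨i, -, rfl⟩ := Finset.mem_image.1 hw
    have := h.lt i
    omega

lemma rankWord_zero : rankWord k b 0 = 0 := by
  rw [rankWord, gapCount, Finset.filter_false_of_mem]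
  · simp
  · intro w hw
    obtain ⟨i, -, rfl⟩ := Finset.mem_image.1 hw
    have := sortedVal_antitone (k := k) (b := b) (Nat.zero_le (sortRank b i))
    rw [sortedVal_sortRank h.lt] at this
    omega

lemma rankWord_succ_early {t : ℕ} (ht : t + 1 ≤ n - k) :
    (sortedVal k b (t + 1) = sortedVal k b t → rankWord k b (t + 1) = rankWord k b t) ∧
    (sortedVal k b (t + 1) < sortedVal k b t → rankWord k b (t + 1) = rankWord k b t + 1) := by
  have e1 : t - (n - k) = 0 := by omega
  have e2 : t + 1 - (n - k) = 0 := by omega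
  unfold rankWord
  rw [e1, e2]
  simp only [zero_add, add_zero]
  refine ⟨fun e => by rw [e], fun hlt => ?_⟩
  rw [gapCount_eq_add hlt.le]
  congr 1
  rw [Finset.card_eq_one]
  refine ⟨sortedVal k b t, ?_⟩
  ext w
  simp only [Finset.mem_filter, Finset.mem_singleton]
  constructor
  · rintro ⟨hw, w1, w2⟩
    obtain ⟨i, -, rfl⟩ := Finset.mem_image.1 hw
    rw [← sortedVal_sortRank h.lt i] at w1 w2 ⊢
    rcases Nat.lt_or_ge t (sortRank b i) with hi | hi
    · have := sortedVal_antitone (k := k) (b := b) (Nat.succ_le_of_lt hi)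
      simp only [Nat.succ_eq_add_one] at this
      omega
    · exact le_antisymm w2 (sortedVal_antitone hi)
  · rintro rfl
    exact ⟨h.sortedVal_mem_image (by omega), hlt, le_rfl⟩

lemma rankWord_succ_late {t : ℕ} (ht : n - k ≤ t) :
    (sortedVal k b (t + 1) = sortedVal k b t → rankWord k b t + 1 = rankWord k b (t + 1) +
      if sortedVal k b (t + 1) + (t + 1 - (n - k)) ∈ Finset.univ.image b then 1 else 0) ∧
    (sortedVal k b (t + 1) < sortedVal k b t → rankWord k b (t + 1) = rankWord k b t + 1) := by
  have e2 : t + 1 - (n - k) = t - (n - k) + 1 := by omega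
  unfold rankWord
  rw [e2]
  constructor
  · intro e
    rw [e, gapCount_succ (b := b) (sortedVal k b t + (t - (n - k)))]
    simp only [← add_assoc]
    split_ifs <;> omega
  · intro hlt
    have := h.sortedVal_le_succ ht
    rw [show sortedVal k b (t + 1) + (t - (n - k) + 1) = sortedVal k b t + (t - (n - k)) by omega]
    omega

lemma rankWord_succ_of_lt {t : ℕ} (hlt : sortedVal k b (t + 1) < sortedVal k b t) :
    rankWord k b (t + 1) = rankWord k b t + 1 := by
  rcases le_or_gt (t + 1) (n - k) with ht | ht
  · exact (h.rankWord_succ_early ht).2 hlt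
  · exact (h.rankWord_succ_late (by omega)).2 hlt

lemma rankWord_succ (t : ℕ) :
    rankWord k b (t + 1) = rankWord k b t ∨ rankWord k b (t + 1) = rankWord k b t + 1 := by
  rcases (sortedVal_antitone (k := k) (b := b) (Nat.le_succ t)).lt_or_eq with hlt | e
  · exact Or.inr (h.rankWord_succ_of_lt hlt)
  · rcases le_or_gt (t + 1) (n - k) with ht | ht
    · exact Or.inl ((h.rankWord_succ_early ht).1 e)
    · have := (h.rankWord_succ_late (t := t) (by omega)).1 e
      split_ifs at this <;> omega

lemma rankWord_monotone : Monotone (rankWord k b) :=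
  monotone_nat_of_le_succ fun t => by rcases h.rankWord_succ t with e | e <;> omega

lemma sortedVal_eq_of_rankWord_eq {t u : ℕ} (e : rankWord k b t = rankWord k b u) :
    sortedVal k b t = sortedVal k b u := by
  wlog htu : t ≤ u generalizing t u
  · exact (this e.symm (by omega)).symm
  induction u, htu using Nat.le_induction with
  | base => rfl
  | succ u hu ih =>
    have m1 := h.rankWord_monotone hu
    have m2 := h.rankWord_monotone (Nat.le_succ u)
    simp only [Nat.succ_eq_add_one] at m2
    rw [ih (by omega)]
    rcases (sortedVal_antitone (k := k) (b := b) (Nat.le_succ u)).lt_or_eq with hlt | e'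
    · have := h.rankWord_succ_of_lt hlt
      omega
    · exact e'.symm

/-- The first rank with a given block index. -/
lemma exists_start {v : ℕ} (hv : v ≤ k) :
    ∃ s ≤ n, (∀ t, rankWord k b t < v ↔ t < s) ∧ rankWord k b s = v ∧
      (1 ≤ v → 1 ≤ s ∧ rankWord k b (s - 1) + 1 = v) ∧ (v < k → s < n) := by
  have h1 := h.one_le
  have h2 := h.le
  have hn : rankWord k b n = k := by rw [h.rankWord_of_last (by omega)]; omega
  have hn1 : rankWord k b (n - 1) = k - 1 := by rw [h.rankWord_of_last (by omega)]; omega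
  have ex : ∃ t, v ≤ rankWord k b t := ⟨n, by omega⟩
  have key : ∀ t, rankWord k b t < v ↔ t < Nat.find ex := by
    intro t
    constructor
    · intro ht
      by_contra hc
      have := h.rankWord_monotone (not_lt.1 hc)
      have := Nat.find_spec ex
      omega
    · intro ht
      exact not_le.1 (Nat.find_min ex ht)
  have sp := Nat.find_spec ex
  have h0 := h.rankWord_zero
  have pos : 1 ≤ v → 1 ≤ Nat.find ex := by
    intro hv1
    exact (key 0).1 (by omega)
  refine ⟨Nat.find ex, Nat.find_min' ex (by omega), key, ?_, ?_, ?_⟩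
  · rcases Nat.eq_zero_or_pos v with rfl | hv1
    · rw [show Nat.find ex = 0 from Nat.le_zero.1 (Nat.find_min' ex (by omega)), h0]
    · have p := pos hv1
      have := (key (Nat.find ex - 1)).2 (by omega)
      have st := h.rankWord_succ (Nat.find ex - 1)
      rw [show Nat.find ex - 1 + 1 = Nat.find ex by omega] at st
      omega
  · intro hv1
    have p := pos hv1
    have := (key (Nat.find ex - 1)).2 (by omega)
    have st := h.rankWord_succ (Nat.find ex - 1)
    rw [show Nat.find ex - 1 + 1 = Nat.find ex by omega] at st
    omega
  · intro hvk
    have : Nat.find ex ≤ n - 1 := Nat.find_min' ex (by omega)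
    omega

end IsReduced

end RankWord

section ReducedWord

variable {n : ℕ}

/-- The word attached to the exponent vector `b`. -/
def reducedWord (k : ℕ) (b : Fin n → ℕ) (i : Fin n) : ℕ := rankWord k b (sortRank b i)

/-- The late block indices `v` for which no letter `v` stands to the left of a letter `v - 1`. -/
def sortedSet (k : ℕ) (w : Fin n → ℕ) : Finset ℕ :=
  (lateSet k w).filter fun v => ¬∃ i j : Fin n, i < j ∧ w i = v ∧ w j + 1 = v

namespace IsReduced

variable {k : ℕ} {b : Fin n → ℕ} (h : IsReduced k b)
include h

lemma start_spec {v : ℕ} (hv : v ≤ k) :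
    (∀ t, rankWord k b t < v ↔ t < countBelow (reducedWord k b) v) ∧
      rankWord k b (countBelow (reducedWord k b) v) = v ∧
      (1 ≤ v → 1 ≤ countBelow (reducedWord k b) v ∧
        rankWord k b (countBelow (reducedWord k b) v - 1) + 1 = v) ∧
      (v < k → countBelow (reducedWord k b) v < n) := by
  obtain ⟨s, hs, h1, h2⟩ := h.exists_start hv
  have : countBelow (reducedWord k b) v = s := by
    unfold countBelow reducedWord
    simp only [h1]
    exact card_sortRank_lt b hs
  rw [this]
  exact ⟨h1, h2⟩

lemma rankWord_start {v : ℕ} (hv : v ≤ k) :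
    rankWord k b (countBelow (reducedWord k b) v) = v := (h.start_spec hv).2.1

lemma reducedWord_lt (i : Fin n) : reducedWord k b i < k :=
  ((h.start_spec le_rfl).1 _).2 <| by
    have h1 := h.one_le
    have h2 := h.le
    have : n - 1 < countBelow (reducedWord k b) k := by
      rw [← (h.start_spec le_rfl).1, h.rankWord_of_last le_rfl]
      omega
    have := sortRank_lt b i
    omega

lemma exists_reducedWord {v : ℕ} (hv : v < k) : ∃ i, reducedWord k b i = v := by
  obtain ⟨h1, h2, h3, h4⟩ := h.start_spec hv.le
  obtain ⟨i, hi⟩ := exists_sortRank b (h4 hv)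
  exact ⟨i, by rw [reducedWord, hi, h2]⟩

lemma start_lt {u v : ℕ} (huv : u < v) (hv : v ≤ k) :
    countBelow (reducedWord k b) u < countBelow (reducedWord k b) v := by
  rw [← (h.start_spec hv).1, h.rankWord_start (huv.le.trans hv)]
  exact huv

lemma start_add_le {u v : ℕ} (huv : u ≤ v) (hv : v ≤ k) :
    countBelow (reducedWord k b) u + (v - u) ≤ countBelow (reducedWord k b) v := by
  induction v, huv using Nat.le_induction with
  | base => simp
  | succ v hu ih =>
    have := h.start_lt (show v < v + 1 by omega) hv
    have := ih (by omega)
    omega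

lemma sortedVal_start (i : Fin n) :
    sortedVal k b (countBelow (reducedWord k b) (reducedWord k b i)) = b i := by
  rw [← sortedVal_sortRank h.lt i]
  exact h.sortedVal_eq_of_rankWord_eq (h.rankWord_start (h.reducedWord_lt i).le)

lemma sortedVal_start_lt {v : ℕ} (h1 : 1 ≤ v) (hv : v < k)
    (hs : v ∉ sortedSet k (reducedWord k b)) :
    sortedVal k b (countBelow (reducedWord k b) v) <
      sortedVal k b (countBelow (reducedWord k b) v - 1) := by
  obtain ⟨s1, s2, s3, s4⟩ := h.start_spec hv.le
  obtain ⟨s3, s5⟩ := s3 h1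
  have es : countBelow (reducedWord k b) v - 1 + 1 = countBelow (reducedWord k b) v := by omega
  by_cases hl : n - k < countBelow (reducedWord k b) v
  · have : ∃ i j : Fin n, i < j ∧ reducedWord k b i = v ∧ reducedWord k b j + 1 = v := by
      by_contra hc
      exact hs (Finset.mem_filter.2 ⟨Finset.mem_filter.2 ⟨Finset.mem_Ico.2 ⟨h1, hv⟩, hl⟩, hc⟩)
    obtain ⟨i, j, hij, hi, hj⟩ := this
    have ei := h.sortedVal_start i
    have ej : sortedVal k b (countBelow (reducedWord k b) v - 1) = b j := by
      rw [← sortedVal_sortRank h.lt j]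
      apply h.sortedVal_eq_of_rankWord_eq
      unfold reducedWord at hj
      omega
    rw [hi] at ei
    rw [ei, ej]
    have : sortRank b j < sortRank b i := by
      by_contra hc
      have := h.rankWord_monotone (not_lt.1 hc)
      unfold reducedWord at hi hj
      omega
    rcases sortRank_lt_iff.1 this with h' | h'
    · exact h'
    · exact absurd h'.2 (by simpa using hij.le)
  · have m := sortedVal_antitone (k := k) (b := b)
      (Nat.sub_le (countBelow (reducedWord k b) v) 1)
    refine lt_of_le_of_ne m fun e => ?_
    have := (h.rankWord_succ_early (t := countBelow (reducedWord k b) v - 1) (by omega)).1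
    rw [es] at this
    have := this e
    omega

lemma sortedVal_start_eq {v : ℕ} (hs : v ∈ sortedSet k (reducedWord k b)) :
    sortedVal k b (countBelow (reducedWord k b) v) =
      sortedVal k b (countBelow (reducedWord k b) v - 1) := by
  obtain ⟨hs1, hs2⟩ := Finset.mem_filter.1 hs
  obtain ⟨hv, hl⟩ := Finset.mem_filter.1 hs1
  obtain ⟨h1, hv⟩ := Finset.mem_Ico.1 hv
  obtain ⟨s1, s2, s3, s4⟩ := h.start_spec hv.le
  obtain ⟨s3, s5⟩ := s3 h1
  replace s4 := s4 hv
  have es : countBelow (reducedWord k b) v - 1 + 1 = countBelow (reducedWord k b) v := by omega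
  have m := sortedVal_antitone (k := k) (b := b) (Nat.sub_le (countBelow (reducedWord k b) v) 1)
  by_contra hne
  have hlt := lt_of_le_of_ne m hne
  have hd := h.sortedVal_le_succ (t := countBelow (reducedWord k b) v - 1) (by omega)
  rw [es] at hd
  have hu := sortedVal_lt (b := b) h.one_le (countBelow (reducedWord k b) v - 1)
  have hcount : countBelow (reducedWord k b) v ≤
      countGe b (sortedVal k b (countBelow (reducedWord k b) v - 1)) := by
    have := (le_sortedVal_iff (b := b) (by omega) hu).1 le_rfl
    omega
  obtain ⟨q, p, hqp, hp, hq⟩ := h.exists_ascent _ (by omega) (hl.trans_le hcount)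
  obtain ⟨i, hi⟩ := exists_sortRank b s4
  obtain ⟨j, hj⟩ := exists_sortRank b (t := countBelow (reducedWord k b) v - 1) (by omega)
  have bi := sortedVal_sortRank h.lt i
  have bj := sortedVal_sortRank h.lt j
  rw [hi] at bi
  rw [hj] at bj
  refine hs2 ⟨i, j, ?_, by rw [reducedWord, hi, s2], by rw [reducedWord, hj, s5]⟩
  have iq : i ≤ q := by
    by_contra hc
    have h1 : sortRank b q < sortRank b i :=
      sortRank_lt_of_lt (Or.inr ⟨by omega, not_le.1 hc⟩)
    have h2 : sortRank b j < sortRank b q := sortRank_lt_of_lt (Or.inl (by omega))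
    omega
  have pj : p ≤ j := by
    by_contra hc
    have h1 : sortRank b j < sortRank b p :=
      sortRank_lt_of_lt (Or.inr ⟨by omega, not_le.1 hc⟩)
    have h2 : sortRank b p < sortRank b i := sortRank_lt_of_lt (Or.inl (by omega))
    omega
  exact (iq.trans_lt hqp).trans_le pj

lemma potential_start_notMem {v : ℕ} (hs : v ∈ sortedSet k (reducedWord k b)) :
    sortedVal k b (countBelow (reducedWord k b) v) + (countBelow (reducedWord k b) v - (n - k)) ∉
      Finset.univ.image b := by
  have he := h.sortedVal_start_eq hs
  obtain ⟨hs1, hs2⟩ := Finset.mem_filter.1 hs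
  obtain ⟨hv, hl⟩ := Finset.mem_filter.1 hs1
  obtain ⟨h1, hv⟩ := Finset.mem_Ico.1 hv
  obtain ⟨s1, s2, s3, s4⟩ := h.start_spec hv.le
  obtain ⟨s3, s5⟩ := s3 h1
  have es : countBelow (reducedWord k b) v - 1 + 1 = countBelow (reducedWord k b) v := by omega
  have := (h.rankWord_succ_late (t := countBelow (reducedWord k b) v - 1) (by omega)).1
  rw [es] at this
  have := this he
  intro hmem
  rw [if_pos hmem] at this
  omega

/-- The permutation of the block indices which matches thresholds with exponents. -/
lemma threshold_code :
    ∃ x : ℕ → ℕ, Set.InjOn x (Finset.range k : Set ℕ) ∧ (∀ v < k, x v < k) ∧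
      ∀ v < k, ∀ u < k, (u < threshold k (reducedWord k b) (sortedSet k (reducedWord k b)) v ↔
        x v < sortedVal k b (countBelow (reducedWord k b) u)) := by
  set w := reducedWord k b with hw
  set S := sortedSet k w with hS
  have hS1 : ∀ v ∈ S, 1 ≤ v ∧ v < k ∧ n - k < countBelow w v := by
    intro v hv
    obtain ⟨hs1, hs2⟩ := Finset.mem_filter.1 hv
    obtain ⟨hv, hl⟩ := Finset.mem_filter.1 hs1
    obtain ⟨h1, hv⟩ := Finset.mem_Ico.1 hv
    exact ⟨h1, hv, hl⟩
  have one_le := h.one_le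
  have le := h.le
  have anti := sortedVal_antitone (k := k) (b := b)
  let x : ℕ → ℕ := fun v => if v ∈ S then sortedVal k b (countBelow w v) + (countBelow w v - (n - k))
    else sortedVal k b (countBelow w v)
  have slt : ∀ {v}, v < k → countBelow w v < n := fun {v} hv => (h.start_spec hv.le).2.2.2 hv
  refine ⟨x, ?_, ?_, ?_⟩
  · have main : ∀ u v, u < v → v < k → x u ≠ x v := by
      intro u v huv hv
      have st := h.start_lt huv hv.le
      rw [← hw] at st
      by_cases hu' : u ∈ S <;> by_cases hv' : v ∈ S
      · have e := h.sortedVal_start_eq hv'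
        rw [← hw] at e
        have := h.potential_mono (t := countBelow w u) (u := countBelow w v - 1)
          (hS1 u hu').2.2.le (by omega)
        simp only [x, if_pos hu', if_pos hv']
        have := hS1 u hu'
        omega
      · have := h.potential_start_notMem hu'
        simp only [x, if_pos hu', if_neg hv']
        exact fun e => this (e ▸ h.sortedVal_mem_image (slt hv))
      · have := h.potential_start_notMem hv'
        simp only [x, if_neg hu', if_pos hv']
        exact fun e => this (e ▸ h.sortedVal_mem_image (slt (huv.trans hv)))
      · have e := h.sortedVal_start_lt (by omega) hv hv'
        rw [← hw] at e
        have := anti (show countBelow w u ≤ countBelow w v - 1 by omega)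
        simp only [x, if_neg hu', if_neg hv']
        omega
    intro u hu v hv e
    simp only [Finset.coe_range, Set.mem_Iio] at hu hv
    rcases lt_trichotomy u v with hlt | heq | hgt
    · exact absurd e (main u v hlt hv)
    · exact heq
    · exact absurd e.symm (main v u hgt hu)
  · intro v hv
    simp only [x]
    split_ifs with hv'
    · have := h.potential_mono (t := countBelow w v) (u := n - 1) (hS1 v hv').2.2.le
        (by have := slt hv; omega)
      rw [h.sortedVal_last le_rfl] at this
      omega
    · exact sortedVal_lt one_le _
  · intro v hv u hu
    have eu : rankWord k b (countBelow w u) = u := h.rankWord_start hu.le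
    have ev : rankWord k b (countBelow w v) = v := h.rankWord_start hv.le
    have cmp : ∀ {p q : ℕ}, p < q → q < k → countBelow w p < countBelow w q :=
      fun hpq hq => h.start_lt hpq hq.le
    have cmp' : ∀ {p q : ℕ}, p ≤ q → q < k → countBelow w p ≤ countBelow w q := by
      intro p q hpq hq
      rcases hpq.lt_or_eq with hlt | rfl
      · exact (cmp hlt hq).le
      · exact le_rfl
    by_cases hv' : v ∈ S
    · simp only [x, threshold, if_pos hv']
      obtain ⟨h1, -, hl⟩ := hS1 v hv'
      have et : v - (countBelow w v - (n - k)) =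
          gapCount b (sortedVal k b (countBelow w v) + (countBelow w v - (n - k))) := by
        unfold rankWord at ev
        omega
      rw [et]
      unfold rankWord at eu ev
      rcases le_or_gt (countBelow w u) (n - k) with hu' | hu'
      · rw [show countBelow w u - (n - k) = 0 by omega, zero_add, add_zero] at eu
        constructor
        · intro hlt
          by_contra hc
          have := gapCount_antitone (b := b) (not_lt.1 hc)
          omega
        · intro hlt
          have := gapCount_lt hlt (h.sortedVal_mem_image (slt hu))
          omega
      · rcases le_or_gt (countBelow w u) (countBelow w v) with huv | huv
        · have pm := h.potential_mono hu'.le huv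
          have := gapCount_antitone (b := b) pm
          constructor <;> intro <;> omega
        · have : v < u := by
            by_contra hc
            have := cmp' (not_lt.1 hc) hv
            omega
          have := anti huv.le
          constructor <;> intro <;> omega
    · simp only [x, threshold, if_neg hv']
      constructor
      · intro huv
        have e := h.sortedVal_start_lt (by omega) hv hv'
        rw [← hw] at e
        have := cmp huv hv
        have := anti (show countBelow w u ≤ countBelow w v - 1 by omega)
        omega
      · intro hlt
        by_contra hc
        have := anti (cmp' (not_lt.1 hc) hu)
        omega

lemma blockExp_sortedSet (i : Fin n) :
    blockExp k (reducedWord k b) (sortedSet k (reducedWord k b)) (reducedWord k b i) = b i := by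
  obtain ⟨x, hinj, hlt, hiff⟩ := h.threshold_code
  have hi := h.reducedWord_lt i
  have e1 : (Finset.Ico 1 k).filter (fun v => reducedWord k b i <
      threshold k (reducedWord k b) (sortedSet k (reducedWord k b)) v) =
      (Finset.range k).filter fun v => x v < b i := by
    ext v
    simp only [Finset.mem_filter, Finset.mem_Ico, Finset.mem_range]
    constructor
    · rintro ⟨⟨h1, hv⟩, h2⟩
      rw [hiff v hv _ hi, h.sortedVal_start] at h2
      exact ⟨hv, h2⟩
    · rintro ⟨hv, h2⟩
      rw [← h.sortedVal_start i, ← hiff v hv _ hi] at h2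
      refine ⟨⟨?_, hv⟩, h2⟩
      by_contra hc
      rw [show v = 0 by omega] at h2
      unfold threshold at h2
      split_ifs at h2 <;> omega
  have e2 : (Finset.range k).image x = Finset.range k := by
    apply Finset.eq_of_subset_of_card_le
    · intro y hy
      obtain ⟨v, hv, rfl⟩ := Finset.mem_image.1 hy
      exact Finset.mem_range.2 (hlt v (Finset.mem_range.1 hv))
    · rw [Finset.card_image_of_injOn hinj]
  have e3 : ((Finset.range k).filter fun v => x v < b i).image x = Finset.range (b i) := by
    ext y
    simp only [Finset.mem_image, Finset.mem_filter, Finset.mem_range]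
    constructor
    · rintro ⟨v, ⟨-, hv⟩, rfl⟩
      exact hv
    · intro hy
      have : y ∈ (Finset.range k).image x := by
        rw [e2]
        exact Finset.mem_range.2 (hy.trans (h.lt i))
      obtain ⟨v, hv, rfl⟩ := Finset.mem_image.1 this
      exact ⟨v, ⟨Finset.mem_range.1 hv, hy⟩, rfl⟩
  rw [blockExp, e1, ← Finset.card_image_of_injOn (f := x), e3, Finset.card_range]
  exact hinj.mono fun v hv => Finset.mem_of_mem_filter v hv

end IsReduced

end ReducedWord

section Spanning

variable (F : Type*) [Field F] {n : ℕ}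

/-- The words of ordered set partitions with `k` blocks. -/
def IsWord (k : ℕ) (w : Fin n → ℕ) : Prop := (∀ i, w i < k) ∧ ∀ v < k, ∃ i, w i = v

variable {F} in
lemma mem_of_sub_mem_lowSpan {U : Submodule F (MvPolynomial (Fin n) F)} {f g : MvPolynomial (Fin n) F}
    {D q : ℕ} (h : f - g ∈ lowSpan F n D q)
    (hU : ∀ c : Fin n → ℕ, ∑ m, c m = D → ∑ m, c m ^ 2 < q → mono F c ∈ U) : f ∈ U ↔ g ∈ U := by
  have : lowSpan F n D q ≤ U := by
    refine Submodule.span_le.2 ?_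
    rintro _ ⟨c, h1, h2, rfl⟩
    exact hU c h1 h2
  have hfg := this h
  have e := Submodule.add_mem_iff_right U (y := g) hfg
  rwa [sub_add_cancel] at e

lemma blockExp_sub_one_eq {k : ℕ} {b : Fin n → ℕ} (h : IsReduced k b) {G : Finset ℕ}
    (hG : G ⊆ lateSet k (reducedWord k b)) {v : ℕ} (hv : v ∈ G) :
    blockExp k (reducedWord k b) G v = blockExp k (reducedWord k b) G (v - 1) := by
  obtain ⟨hvk, hvl⟩ := Finset.mem_filter.1 (hG hv)
  rw [Finset.mem_Ico] at hvk
  unfold blockExp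
  congr 1
  refine Finset.filter_congr fun u hu => ?_
  have : threshold k (reducedWord k b) G u ≠ v := by
    unfold threshold
    split_ifs with hu'
    · intro e
      rw [Finset.mem_Ico] at hu
      obtain ⟨-, hul⟩ := Finset.mem_filter.1 (hG hu')
      have := h.start_add_le (show v ≤ u by omega) hu.2.le
      omega
    · rintro rfl
      exact hu' hv
  omega

lemma wordAtom_eq_zero {k : ℕ} {b : Fin n → ℕ} (h : IsReduced k b) {G : Finset ℕ}
    (hG : G ⊆ lateSet k (reducedWord k b)) (hGS : ¬G ⊆ sortedSet k (reducedWord k b)) :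
    wordAtom F k (reducedWord k b) G = 0 := by
  obtain ⟨v, hv, hvS⟩ := Finset.not_subset.1 hGS
  have : ∃ i j : Fin n, i < j ∧ reducedWord k b i = v ∧ reducedWord k b j + 1 = v := by
    by_contra hc
    exact hvS (Finset.mem_filter.2 ⟨hG hv, hc⟩)
  obtain ⟨i, j, hij, hi, hj⟩ := this
  rw [wordAtom, if_pos]
  refine ⟨i, j, hij, by omega, ?_⟩
  rw [hi, show reducedWord k b j = v - 1 by omega, blockExp_sub_one_eq h hG hv]

lemma wordAtom_sortedSet {k : ℕ} {b : Fin n → ℕ} (h : IsReduced k b) :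
    wordAtom F k (reducedWord k b) (sortedSet k (reducedWord k b)) = atom F b := by
  rw [wordAtom, if_neg]
  · congr 1
    ext i
    exact h.blockExp_sortedSet i
  · rintro ⟨i, j, hij, hlt, e⟩
    rw [h.blockExp_sortedSet, h.blockExp_sortedSet] at e
    have := h.rankWord_monotone (sortRank_lt_of_lt (Or.inr ⟨e, hij⟩)).le
    unfold reducedWord at hlt
    omega

lemma sum_lt_sum_blockExp {k : ℕ} {b : Fin n → ℕ} (h : IsReduced k b) {G : Finset ℕ}
    (hG : G ⊂ sortedSet k (reducedWord k b)) :
    ∑ i, b i < ∑ i, blockExp k (reducedWord k b) G (reducedWord k b i) := by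
  obtain ⟨hG1, hG2⟩ := hG
  obtain ⟨v, hv, hvG⟩ := Finset.not_subset.1 hG2
  obtain ⟨hvk, hvl⟩ := Finset.mem_filter.1 (Finset.mem_filter.1 hv).1
  have hvk' := Finset.mem_Ico.1 hvk
  have key : ∀ u, threshold k (reducedWord k b) (sortedSet k (reducedWord k b)) u ≤
      threshold k (reducedWord k b) G u := by
    intro u
    unfold threshold
    by_cases hu : u ∈ G
    · rw [if_pos hu, if_pos (hG1 hu)]
    · rw [if_neg hu]
      split_ifs <;> omega
  have le : ∀ y, blockExp k (reducedWord k b) (sortedSet k (reducedWord k b)) y ≤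
      blockExp k (reducedWord k b) G y := by
    intro y
    refine Finset.card_le_card fun u hu => ?_
    rw [Finset.mem_filter] at hu ⊢
    exact ⟨hu.1, hu.2.trans_le (key u)⟩
  have ht : threshold k (reducedWord k b) (sortedSet k (reducedWord k b)) v < v := by
    rw [threshold, if_pos hv]
    omega
  obtain ⟨i, hi⟩ := h.exists_reducedWord (ht.trans hvk'.2)
  refine Finset.sum_lt_sum (fun m _ => ?_) ⟨i, Finset.mem_univ i, ?_⟩
  · rw [← h.blockExp_sortedSet m]
    exact le _
  · rw [← h.blockExp_sortedSet i]
    refine Finset.card_lt_card ⟨fun u hu => ?_, fun hs => ?_⟩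
    · rw [Finset.mem_filter] at hu ⊢
      exact ⟨hu.1, hu.2.trans_le (key u)⟩
    · have hvt : threshold k (reducedWord k b) G v = v := by rw [threshold, if_neg hvG]
      have := @hs v (Finset.mem_filter.2 ⟨hvk, by rw [hi, hvt]; exact ht⟩)
      rw [Finset.mem_filter, hi] at this
      exact lt_irrefl _ this.2

/-- Every monomial is congruent to a combination of word polynomials modulo `Jideal`. -/
lemma mono_mem_span {k : ℕ} (hk : 1 ≤ k) (hkn : k ≤ n)
    {U : Submodule F (MvPolynomial (Fin n) F)} (hJ : ∀ f ∈ Jideal F n k, f ∈ U)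
    (hW : ∀ w : Fin n → ℕ, IsWord k w → wordPoly F k w ∈ U) (b : Fin n → ℕ) : mono F b ∈ U := by
  induction b using exponent_induction (n * k) with
  | h b ihD ihQ ihP =>
  by_cases hb : ∃ i, k ≤ b i
  · exact (mem_of_sub_mem_lowSpan (atom_sub_mono_mem F b) ihQ).1 (hJ _ (atom_mem_Jideal F hk b hb))
  by_cases hc : ∃ v, 1 ≤ v ∧ n - k < countGe b v ∧ ∀ p q, b p = v → b q + 1 = v → p < q
  · obtain ⟨v, hv, hcard, hpos⟩ := hc
    exact mono_mem_of_column F hJ hv hcard hpos ihQ ihP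
  have h : IsReduced k b := by
    refine ⟨hk, hkn, fun i => not_le.1 fun hi => hb ⟨i, hi⟩, fun v hv hl => ?_⟩
    by_contra hn
    refine hc ⟨v, hv, hl, fun p q hp hq => ?_⟩
    by_contra hpq
    have : p ≠ q := by
      rintro rfl
      omega
    exact hn ⟨q, p, lt_of_le_of_ne (not_lt.1 hpq) this.symm, hp, hq⟩
  have hdeg : ∑ m, b m < n * k := by
    have : ∑ m, b m < ∑ _m : Fin n, k :=
      Finset.sum_lt_sum_of_nonempty ⟨⟨0, by omega⟩, Finset.mem_univ _⟩ fun i _ => h.lt i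
    simpa using this
  refine (mem_of_sub_mem_lowSpan (atom_sub_mono_mem F b) ihQ).1 ?_
  have hw := hW _ ⟨h.reducedWord_lt, fun v hv => h.exists_reducedWord hv⟩
  have hS : sortedSet k (reducedWord k b) ∈ (lateSet k (reducedWord k b)).powerset :=
    Finset.mem_powerset.2 (Finset.filter_subset _ _)
  rw [wordPoly, ← Finset.add_sum_erase _ _ hS, wordAtom_sortedSet F h] at hw
  refine (U.add_mem_iff_left (Submodule.sum_mem _ fun G hG => ?_)).1 hw
  rw [Finset.mem_erase, Finset.mem_powerset] at hG
  by_cases hGS : G ⊆ sortedSet k (reducedWord k b)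
  · have hlt := sum_lt_sum_blockExp h (Finset.ssubset_iff_subset_ne.2 ⟨hGS, hG.1⟩)
    have big : ∀ c : Fin n → ℕ, ∑ m, c m =
        ∑ i, blockExp k (reducedWord k b) G (reducedWord k b i) → mono F c ∈ U :=
      fun c hc => ihD c (by omega)
    unfold wordAtom
    split_ifs
    · exact zero_mem _
    · exact (mem_of_sub_mem_lowSpan (atom_sub_mono_mem F _) fun c hc _ => big c hc).2 (big _ rfl)
  · rw [wordAtom_eq_zero F h hG.2 hGS]
    exact zero_mem _

end Spanning

section Evaluation

variable (F : Type*) [Field F] {K : Type*} [Field K] [Algebra F K] {n : ℕ} {Ω : Type*}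

/-- Evaluation of polynomials on a family of points. -/
def evalPts (z : Ω → Fin n → K) : MvPolynomial (Fin n) F →ₐ[F] (Ω → K) := aeval fun i ω => z ω i

lemma evalPts_apply (z : Ω → Fin n → K) (f : MvPolynomial (Fin n) F) (ω : Ω) :
    evalPts F z f ω = aeval (z ω) f := by
  have : (Pi.evalAlgHom F (fun _ : Ω => K) ω).comp (evalPts F z) = aeval (z ω) := by
    ext i
    simp [evalPts]
  exact DFunLike.congr_fun this f

/-- The functions on a family of points spanned by the monomials of degree less than `d`. -/
def lowVals (z : Ω → Fin n → K) (d : ℕ) : Submodule K (Ω → K) :=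
  Submodule.span K {v | ∃ a : Fin n → ℕ, ∑ i, a i < d ∧ v = evalPts F z (mono F a)}

lemma mono_isHomogeneous (a : Fin n → ℕ) : (mono F a).IsHomogeneous (∑ i, a i) := by
  rw [mono_eq_monomial]
  refine isHomogeneous_monomial _ ?_
  simp [Finsupp.degree_eq_sum]

/-- Induction principle for linear properties of polynomials. -/
lemma mem_of_mono_mem {U : Submodule F (MvPolynomial (Fin n) F)} (h : ∀ a, mono F a ∈ U)
    (f : MvPolynomial (Fin n) F) : f ∈ U := by
  rw [f.as_sum]
  refine U.sum_mem fun s _ => ?_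
  rw [← mul_one (coeff s f), ← smul_eq_mul, ← smul_monomial, monomial_eq_mono]
  exact U.smul_mem _ (h _)

variable {F}

lemma evalPts_mem_lowVals {f : MvPolynomial (Fin n) F} {d e : ℕ} (hf : f.IsHomogeneous d)
    (hde : d < e) (z : Ω → Fin n → K) : evalPts F z f ∈ lowVals F z e := by
  rw [f.as_sum, map_sum]
  refine Submodule.sum_mem _ fun s hs => ?_
  rw [← mul_one (coeff s f), ← smul_eq_mul, ← smul_monomial, monomial_eq_mono, map_smul,
    ← algebraMap_smul K]
  refine Submodule.smul_mem _ _ (Submodule.subset_span ⟨s, ?_, rfl⟩)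
  have : Finsupp.weight (fun _ => 1) s = d := hf (mem_support_iff.1 hs)
  rw [← Finsupp.degree_eq_weight_one, Finsupp.degree_eq_sum] at this
  omega

lemma mono_mul_mem_lowVals {z : Ω → Fin n → K} {d : ℕ} {v : Ω → K} (hv : v ∈ lowVals F z d)
    (a : Fin n → ℕ) : evalPts F z (mono F a) * v ∈ lowVals F z (∑ i, a i + d) := by
  have : lowVals F z d ≤
      (lowVals F z (∑ i, a i + d)).comap (LinearMap.mulLeft K (evalPts F z (mono F a))) := by
    refine Submodule.span_le.2 ?_
    rintro _ ⟨b, hb, rfl⟩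
    refine Submodule.subset_span ⟨a + b, ?_, ?_⟩
    · simp only [Pi.add_apply, Finset.sum_add_distrib]
      omega
    · rw [mono_add, map_mul, LinearMap.mulLeft_apply]
  exact this hv

lemma homogeneousComponent_evalPts_mem {z : Ω → Fin n → K} {G : Set (MvPolynomial (Fin n) F)}
    (hG : ∀ g ∈ G, ∃ d, g.IsHomogeneous d ∧ evalPts F z g ∈ lowVals F z d)
    {f : MvPolynomial (Fin n) F} (hf : f ∈ Ideal.span G) (d : ℕ) :
    evalPts F z (homogeneousComponent d f) ∈ lowVals F z d := by
  suffices h : ∀ r : MvPolynomial (Fin n) F,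
      evalPts F z (homogeneousComponent d (r * f)) ∈ lowVals F z d by
    simpa using h 1
  induction hf using Submodule.span_induction with
  | mem g hg =>
    obtain ⟨e, he, hge⟩ := hG g hg
    let U : Submodule F (MvPolynomial (Fin n) F) :=
      ((lowVals F z d).restrictScalars F).comap ((evalPts F z).toLinearMap ∘ₗ
        homogeneousComponent d ∘ₗ LinearMap.mulRight F g)
    refine mem_of_mono_mem F (U := U) fun a => ?_
    change evalPts F z (homogeneousComponent d (mono F a * g)) ∈ lowVals F z d
    rw [homogeneousComponent_of_mem (n := ∑ i, a i + e) ((mono_isHomogeneous F a).mul he)]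
    split_ifs with h
    · rw [h, map_mul]
      exact mono_mul_mem_lowVals hge a
    · rw [map_zero]
      exact zero_mem _
  | zero => simp
  | add x y _ _ hx hy =>
    intro r
    rw [mul_add, map_add, map_add]
    exact add_mem (hx r) (hy r)
  | smul s x _ hx =>
    intro r
    rw [smul_eq_mul, ← mul_assoc]
    exact hx _

lemma span_evalPts_mono_eq_top [Finite Ω] {z : Ω → Fin n → K} (hz : Function.Injective z) :
    Submodule.span K (Set.range fun a => evalPts F z (mono F a)) = ⊤ := by
  have := Fintype.ofFinite Ω
  have hA : ∀ ω ω' : Ω, ω' ≠ ω → ∃ f : MvPolynomial (Fin n) K,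
      aeval (z ω) f = 1 ∧ aeval (z ω') f = 0 := by
    intro ω ω' hne
    obtain ⟨i, hi⟩ := Function.ne_iff.1 (hz.ne hne)
    refine ⟨C (z ω i - z ω' i)⁻¹ * (X i - C (z ω' i)), ?_, ?_⟩
    · simp [sub_ne_zero.2 (Ne.symm hi)]
    · simp
  choose! p hp1 hp0 using hA
  have hmono : ∀ f : MvPolynomial (Fin n) K, evalPts K z f ∈
      Submodule.span K (Set.range fun a => evalPts F z (mono F a)) := by
    intro f
    refine mem_of_mono_mem K (U := Submodule.comap (evalPts K z).toLinearMap
      (Submodule.span K (Set.range fun a => evalPts F z (mono F a)))) (fun a => ?_) f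
    refine Submodule.subset_span ⟨a, ?_⟩
    simp [mono, evalPts]
  refine eq_top_iff.2 fun v _ => ?_
  have hv : v = ∑ ω, v ω • evalPts K z (∏ ω' ∈ Finset.univ.erase ω, p ω ω') := by
    ext ω
    rw [Finset.sum_apply, Finset.sum_eq_single ω]
    · rw [Pi.smul_apply, evalPts_apply, map_prod, Finset.prod_eq_one, smul_eq_mul, mul_one]
      intro ω' hω'
      exact hp1 _ _ (Finset.ne_of_mem_erase hω')
    · intro ω₁ _ hne
      rw [Pi.smul_apply, evalPts_apply, map_prod,
        Finset.prod_eq_zero (Finset.mem_erase.2 ⟨hne.symm, Finset.mem_univ ω⟩)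
          (hp0 _ _ hne.symm), smul_zero]
    · simp
  rw [hv]
  exact Submodule.sum_mem _ fun ω _ => Submodule.smul_mem _ _ (hmono _)

/-- The number of points is at most the dimension of the quotient by the top degree parts of
equations they satisfy. -/
lemma card_le_finrank_quotient [Finite Ω] {z : Ω → Fin n → K} (hz : Function.Injective z)
    {G : Set (MvPolynomial (Fin n) F)}
    (hG : ∀ g ∈ G, ∃ d, g.IsHomogeneous d ∧ evalPts F z g ∈ lowVals F z d)
    [Module.Finite F (MvPolynomial (Fin n) F ⧸ Ideal.span G)] :
    Nat.card Ω ≤ Module.finrank F (MvPolynomial (Fin n) F ⧸ Ideal.span G) := by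
  have := Fintype.ofFinite Ω
  let mkL : MvPolynomial (Fin n) F →ₗ[F] (MvPolynomial (Fin n) F ⧸ Ideal.span G) :=
    (Ideal.Quotient.mkₐ F (Ideal.span G)).toLinearMap
  obtain ⟨κ, a, -, hspan, hli⟩ := exists_linearIndependent' F fun b : Fin n → ℕ => mkL (mono F b)
  have : Finite κ := hli.finite_of_isNoetherian
  have := Fintype.ofFinite κ
  have hκ : Fintype.card κ ≤ Module.finrank F (MvPolynomial (Fin n) F ⧸ Ideal.span G) :=
    hli.fintype_card_le_finrank
  refine le_trans ?_ hκ
  let M : Submodule K (Ω → K) := Submodule.span K (Set.range fun t => evalPts F z (mono F (a t)))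
  have hM : ∀ d, ∀ b : Fin n → ℕ, ∑ i, b i = d → evalPts F z (mono F b) ∈ M := by
    intro d
    induction d using Nat.strong_induction_on with
    | _ d ih =>
    intro b hb
    have hlow : lowVals F z d ≤ M := by
      refine Submodule.span_le.2 ?_
      rintro _ ⟨c, hc, rfl⟩
      exact ih _ hc c rfl
    have hmem : mkL (mono F b) ∈ Submodule.span F (Set.range ((fun b => mkL (mono F b)) ∘ a)) := by
      rw [hspan]
      exact Submodule.subset_span ⟨b, rfl⟩
    obtain ⟨c, hc⟩ := (Submodule.mem_span_range_iff_exists_fun F).1 hmem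
    have hJ : mono F b - ∑ t, c t • mono F (a t) ∈ Ideal.span G := by
      rw [← Ideal.Quotient.eq_zero_iff_mem]
      change mkL _ = 0
      rw [map_sub, map_sum, sub_eq_zero, ← hc]
      exact Finset.sum_congr rfl fun t _ => by simp
    have := hlow (homogeneousComponent_evalPts_mem hG hJ d)
    rw [map_sub, map_sub, homogeneousComponent_of_mem (mono_isHomogeneous F b), if_pos hb.symm,
      map_sum, map_sum] at this
    refine (M.sub_mem_iff_left (M.sum_mem fun t _ => ?_)).1 this
    rw [map_smul, map_smul, homogeneousComponent_of_mem (mono_isHomogeneous F (a t)),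
      ← algebraMap_smul K]
    refine M.smul_mem _ ?_
    split_ifs
    · exact Submodule.subset_span ⟨t, rfl⟩
    · rw [map_zero]
      exact zero_mem _
  have htop : M = ⊤ := by
    rw [eq_top_iff, ← span_evalPts_mono_eq_top (F := F) hz, Submodule.span_le]
    rintro _ ⟨b, rfl⟩
    exact hM _ b rfl
  have hfin := finrank_range_le_card (R := K) fun t => evalPts F z (mono F (a t))
  rw [Set.finrank, show Submodule.span K _ = M from rfl, htop, finrank_top,
    Module.finrank_fintype_fun_eq_card] at hfin
  rwa [Nat.card_eq_fintype_card]

end Evaluation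

section LinearFactors

variable {K : Type*} [Field K]

lemma coeff_prod_linear_eq_zero {ι : Type*} (s : Finset ι) (b : ι → K) {d : ℕ} (h : s.card < d) :
    PowerSeries.coeff d (∏ i ∈ s, (1 + PowerSeries.C (b i) * PowerSeries.X)) = 0 := by
  induction s using Finset.induction_on generalizing d with
  | empty =>
    rw [Finset.prod_empty, PowerSeries.coeff_one, if_neg]
    rw [Finset.card_empty] at h
    omega
  | insert i s hi ih =>
    rw [Finset.card_insert_of_notMem hi] at h
    obtain ⟨d, rfl⟩ : ∃ e, d = e + 1 := ⟨d - 1, by omega⟩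
    rw [Finset.prod_insert hi, add_mul, one_mul, map_add, ih (by omega), mul_assoc,
      PowerSeries.coeff_C_mul, PowerSeries.coeff_succ_X_mul, ih (by omega), mul_zero, add_zero]

lemma constantCoeff_prod_linear {ι : Type*} (s : Finset ι) (b : ι → K) :
    PowerSeries.constantCoeff (∏ i ∈ s, (1 + PowerSeries.C (b i) * PowerSeries.X)) = 1 := by
  rw [map_prod]
  exact Finset.prod_eq_one fun i _ => by simp

variable (F : Type*) [Field F] [Algebra F K] {n : ℕ}

lemma mk_hpoly_mul (y : Fin n → K) {m : ℕ} (hm : m ≤ n) :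
    PowerSeries.mk (fun a => aeval y (hpoly F n a m)) *
      ∏ j ∈ Finset.univ.filter (fun j : Fin n => (j : ℕ) < m),
        (1 + PowerSeries.C (-y j) * PowerSeries.X) = 1 := by
  induction m with
  | zero =>
    simp only [Nat.not_lt_zero, Finset.filter_false, Finset.prod_empty, mul_one]
    ext a
    rw [PowerSeries.coeff_mk, PowerSeries.coeff_one]
    cases a with
    | zero => simp [hpoly_zero_left]
    | succ a => simp [hpoly_succ_zero]
  | succ m ih =>
    let i : Fin n := ⟨m, hm⟩
    have hs : Finset.univ.filter (fun j : Fin n => (j : ℕ) < m + 1) =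
        insert i (Finset.univ.filter fun j : Fin n => (j : ℕ) < m) := by
      ext j
      simp only [Finset.mem_filter, Finset.mem_univ, true_and, Finset.mem_insert, Fin.ext_iff, i]
      omega
    rw [hs, Finset.prod_insert (by simp [i]), ← mul_assoc]
    refine Eq.trans ?_ (ih (by omega))
    congr 1
    ext a
    rw [mul_comm, add_mul, one_mul, map_add, mul_assoc, PowerSeries.coeff_C_mul,
      PowerSeries.coeff_mk, PowerSeries.coeff_mk]
    cases a with
    | zero => simp [hpoly_zero_left]
    | succ a =>
      rw [PowerSeries.coeff_succ_X_mul, PowerSeries.coeff_mk]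
      have := hpoly_succ_succ F a i
      rw [show (i : ℕ) = m from rfl] at this
      rw [this, map_add, map_mul, aeval_X]
      ring

lemma mk_esymm_eq (y : Fin n → K) :
    PowerSeries.mk (fun d => aeval y (esymm (Fin n) F d)) =
      ∏ j, (1 + PowerSeries.C (y j) * PowerSeries.X) := by
  ext d
  rw [PowerSeries.coeff_mk, Finset.prod_one_add, map_sum, esymm, map_sum, Finset.powersetCard_eq_filter,
    Finset.sum_filter]
  refine Finset.sum_congr rfl fun t _ => ?_
  rw [Finset.prod_mul_distrib, Finset.prod_const, ← map_prod, PowerSeries.coeff_C_mul,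
    PowerSeries.coeff_X_pow]
  by_cases h : t.card = d
  · simp [h]
  · simp [h, Ne.symm h]

end LinearFactors

section Points

variable {n : ℕ}

/-- The earlier positions of the letter at a given position. -/
def earlier (w : Fin n → ℕ) (i : Fin n) : Finset (Fin n) :=
  Finset.univ.filter fun j => j < i ∧ w j = w i

/-- The labels of the coordinates of the point attached to a word: a first occurrence of a letter
is labelled by the letter, any other position by its predecessor with the same letter. -/
def pointLabel (k : ℕ) (w : Fin n → ℕ) (i : Fin n) : ℕ :=
  if h : (earlier w i).Nonempty then k + ((earlier w i).max' h : ℕ) else w i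

lemma pointLabel_cases (k : ℕ) (w : Fin n → ℕ) (i : Fin n) :
    (pointLabel k w i = w i ∧ ∀ j < i, w j ≠ w i) ∨
      ∃ j < i, w j = w i ∧ pointLabel k w i = k + j ∧ ∀ l < i, w l = w i → l ≤ j := by
  unfold pointLabel
  split_ifs with h
  · right
    have := Finset.max'_mem _ h
    replace this := (Finset.mem_filter.1 this).2
    refine ⟨(earlier w i).max' h, this.1, this.2, rfl, fun l hl hw => ?_⟩
    exact Finset.le_max' _ _ (Finset.mem_filter.2 ⟨Finset.mem_univ l, hl, hw⟩)
  · left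
    refine ⟨rfl, fun j hj hw => h ⟨j, Finset.mem_filter.2 ⟨Finset.mem_univ j, hj, hw⟩⟩⟩

variable {k : ℕ} {w : Fin n → ℕ}

lemma pointLabel_lt (hw : ∀ i, w i < k) (i : Fin n) : pointLabel k w i < k + i := by
  rcases pointLabel_cases k w i with ⟨h, -⟩ | ⟨j, hj, -, h, -⟩
  · have := hw i
    omega
  · rw [Fin.lt_def] at hj
    omega

lemma pointLabel_injective (hw : ∀ i, w i < k) : Function.Injective (pointLabel k w) := by
  intro i i' e
  have hi := hw i
  have hi' := hw i'
  rcases pointLabel_cases k w i with ⟨h, h1⟩ | ⟨j, hj, hjw, h, h1⟩ <;>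
    rcases pointLabel_cases k w i' with ⟨h', h1'⟩ | ⟨j', hj', hjw', h', h1'⟩
  · rcases lt_trichotomy i i' with hl | rfl | hl
    · exact absurd (by omega) (h1' i hl)
    · rfl
    · exact absurd (by omega) (h1 i' hl)
  · omega
  · omega
  · obtain rfl : j = j' := Fin.ext (by omega)
    rcases lt_trichotomy i i' with hl | rfl | hl
    · exact absurd (h1' i hl (hjw.symm.trans hjw')) (not_le.2 hj)
    · rfl
    · exact absurd (h1 i' hl (hjw'.symm.trans hjw)) (not_le.2 hj')

lemma exists_pointLabel_eq {i : Fin n} : ∃ j, pointLabel k w j = w i := by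
  have hne : (Finset.univ.filter fun j => w j = w i).Nonempty :=
    ⟨i, Finset.mem_filter.2 ⟨Finset.mem_univ i, rfl⟩⟩
  have hmem := Finset.min'_mem _ hne
  rw [Finset.mem_filter] at hmem
  refine ⟨Finset.min' _ hne, ?_⟩
  rcases pointLabel_cases k w (Finset.min' _ hne) with ⟨h, -⟩ | ⟨j, hj, hjw, -⟩
  · exact h.trans hmem.2
  · exact absurd (Finset.min'_le _ j (Finset.mem_filter.2 ⟨Finset.mem_univ j, hjw.trans hmem.2⟩))
      (not_le.2 hj)

lemma eq_of_pointLabel_eq {w' : Fin n → ℕ} (hw : ∀ i, w i < k) (hw' : ∀ i, w' i < k)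
    (h : pointLabel k w = pointLabel k w') : w = w' := by
  ext i
  induction i using WellFoundedLT.induction with
  | _ i ih =>
  have hi := hw i
  have hi' := hw' i
  have e := congrFun h i
  rcases pointLabel_cases k w i with ⟨h1, -⟩ | ⟨j, hj, hjw, h1, -⟩ <;>
    rcases pointLabel_cases k w' i with ⟨h1', -⟩ | ⟨j', hj', hjw', h1', -⟩
  · omega
  · omega
  · omega
  · obtain rfl : j = j' := Fin.ext (by omega)
    rw [← hjw, ← hjw', ih j hj]

end Points

section LowerBound

variable (F : Type*) [Field F] {K : Type*} [Field K] [Algebra F K] {n : ℕ} {Ω : Type*}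

lemma esymm_isHomogeneous (d : ℕ) : (esymm (Fin n) F d).IsHomogeneous d := by
  refine IsHomogeneous.sum _ _ _ fun t ht => ?_
  have := IsHomogeneous.prod t (fun i => (X i : MvPolynomial (Fin n) F)) (fun _ => 1)
    fun i _ => isHomogeneous_X F i
  rwa [Finset.sum_const, smul_eq_mul, mul_one, (Finset.mem_powersetCard.1 ht).2] at this

lemma hpoly_isHomogeneous (d m : ℕ) : (hpoly F n d m).IsHomogeneous d := by
  refine IsHomogeneous.sum _ _ _ fun s _ => ?_
  have key : ∀ t : Multiset (Fin n),
      ((t.map X).prod : MvPolynomial (Fin n) F).IsHomogeneous t.card := by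
    intro t
    induction t using Multiset.induction_on with
    | empty => simpa using isHomogeneous_one (Fin n) F
    | cons i t ih =>
      rw [Multiset.map_cons, Multiset.prod_cons, Multiset.card_cons, add_comm]
      exact (isHomogeneous_X F i).mul ih
  have := key s.1
  rwa [s.2] at this

variable {F}

lemma evalPts_mem_of_recurrence {z : Ω → Fin n → K} {p : ℕ → MvPolynomial (Fin n) F}
    (hp : ∀ a, (p a).IsHomogeneous a) {d : ℕ} {c : PowerSeries K}
    (hc : PowerSeries.constantCoeff c = 1)
    (h : ∀ ω, PowerSeries.coeff d (c * PowerSeries.mk fun a => aeval (z ω) (p a)) = 0) :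
    evalPts F z (p d) ∈ lowVals F z d := by
  have e : ∑ x ∈ Finset.HasAntidiagonal.antidiagonal d, PowerSeries.coeff x.1 c • evalPts F z (p x.2) = 0 := by
    ext ω
    have := h ω
    rw [PowerSeries.coeff_mul] at this
    rw [Finset.sum_apply, Pi.zero_apply, ← this]
    refine Finset.sum_congr rfl fun x _ => ?_
    rw [Pi.smul_apply, evalPts_apply, PowerSeries.coeff_mk, smul_eq_mul]
  have h0 : ((0, d) : ℕ × ℕ) ∈ Finset.HasAntidiagonal.antidiagonal d := by simp
  rw [← Finset.add_sum_erase _ _ h0, PowerSeries.coeff_zero_eq_constantCoeff_apply, hc, one_smul,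
    add_eq_zero_iff_eq_neg] at e
  rw [e]
  refine neg_mem (Submodule.sum_mem _ fun x hx => Submodule.smul_mem _ _ ?_)
  rw [Finset.mem_erase, Finset.HasAntidiagonal.mem_antidiagonal] at hx
  refine evalPts_mem_lowVals (hp x.2) ?_ z
  have : x.1 ≠ 0 := fun h0 => hx.1 (Prod.ext h0 (by simp; omega))
  omega

lemma evalPts_hpoly_mem {k : ℕ} (hk : 1 ≤ k) (α : ℕ → K) {ζ : Ω → Fin n → ℕ}
    (hlt : ∀ ω i, ζ ω i < k + i) (hinj : ∀ ω, Function.Injective (ζ ω)) {m : ℕ} (h1 : 1 ≤ m)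
    (hm : m ≤ n) :
    evalPts F (fun ω i => α (ζ ω i)) (hpoly F n k m) ∈
      lowVals F (fun ω i => α (ζ ω i)) k := by
  refine evalPts_mem_of_recurrence (p := fun a => hpoly F n a m)
    (fun a => hpoly_isHomogeneous F a m)
    (constantCoeff_prod_linear (Finset.range (k + m - 1)) fun i => -α i) fun ω => ?_
  let T := (Finset.univ.filter fun j : Fin n => (j : ℕ) < m).image (ζ ω)
  have hT : T ⊆ Finset.range (k + m - 1) := by
    intro v hv
    obtain ⟨j, hj, rfl⟩ := Finset.mem_image.1 hv
    have := hlt ω j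
    rw [Finset.mem_filter] at hj
    rw [Finset.mem_range]
    omega
  have hcard : T.card = m := by
    rw [Finset.card_image_of_injective _ (hinj ω), Fin.card_filter_val_lt]
    omega
  have e := mk_hpoly_mul F (fun i => α (ζ ω i)) hm
  rw [← Finset.prod_image (s := Finset.univ.filter fun j : Fin n => (j : ℕ) < m) (g := ζ ω)
    (f := fun v => 1 + PowerSeries.C (-α v) * PowerSeries.X) (hinj ω).injOn] at e
  rw [← Finset.prod_sdiff hT, mul_assoc, mul_comm (∏ i ∈ T, _), e, mul_one]
  refine coeff_prod_linear_eq_zero _ _ ?_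
  rw [Finset.card_sdiff_of_subset hT, Finset.card_range]
  omega

lemma evalPts_esymm_mem {k : ℕ} (α : ℕ → K) {ζ : Ω → Fin n → ℕ}
    (hinj : ∀ ω, Function.Injective (ζ ω)) (hsurj : ∀ ω, ∀ v < k, ∃ i, ζ ω i = v) {d : ℕ}
    (hd : n - k < d) :
    evalPts F (fun ω i => α (ζ ω i)) (esymm (Fin n) F d) ∈
      lowVals F (fun ω i => α (ζ ω i)) d := by
  have hc := constantCoeff_prod_linear (Finset.range k) α
  refine evalPts_mem_of_recurrence (p := fun a => esymm (Fin n) F a) (esymm_isHomogeneous F)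
    (c := (∏ i ∈ Finset.range k, (1 + PowerSeries.C (α i) * PowerSeries.X))⁻¹)
    (by rw [PowerSeries.constantCoeff_inv, hc, inv_one]) fun ω => ?_
  have hT : Finset.range k ⊆ Finset.univ.image (ζ ω) := by
    intro v hv
    obtain ⟨i, hi⟩ := hsurj ω v (Finset.mem_range.1 hv)
    exact Finset.mem_image.2 ⟨i, Finset.mem_univ i, hi⟩
  rw [mk_esymm_eq, ← Finset.prod_image (s := Finset.univ) (g := ζ ω)
    (f := fun v => 1 + PowerSeries.C (α v) * PowerSeries.X) (hinj ω).injOn,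
    ← Finset.prod_sdiff hT, mul_comm (∏ i ∈ _ \ _, _), ← mul_assoc,
    PowerSeries.inv_mul_cancel _ (by rw [hc]; exact one_ne_zero), one_mul]
  refine coeff_prod_linear_eq_zero _ _ ?_
  rw [Finset.card_sdiff_of_subset hT, Finset.card_range, Finset.card_image_of_injective _ (hinj ω),
    Finset.card_univ, Fintype.card_fin]
  exact hd

variable (F)

lemma finite_isWord (n k : ℕ) : Finite {w : Fin n → ℕ // IsWord k w} :=
  Finite.of_injective (fun w i => (⟨w.1 i, w.2.1 i⟩ : Fin k)) fun _ _ h =>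
    Subtype.ext (funext fun i => congrArg Fin.val (congrFun h i))

lemma card_isWord_le_finrank {k : ℕ} (hk : 1 ≤ k)
    [Module.Finite F (MvPolynomial (Fin n) F ⧸ Jideal F n k)] :
    Nat.card {w : Fin n → ℕ // IsWord k w} ≤
      Module.finrank F (MvPolynomial (Fin n) F ⧸ Jideal F n k) := by
  have := finite_isWord n k
  let α := Infinite.natEmbedding (AlgebraicClosure F)
  let ζ : {w : Fin n → ℕ // IsWord k w} → Fin n → ℕ := fun w => pointLabel k w.1
  have hinj : ∀ w, Function.Injective (ζ w) := fun w => pointLabel_injective w.2.1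
  have hz : Function.Injective fun (w : {w : Fin n → ℕ // IsWord k w}) i => α (ζ w i) := by
    intro w w' h
    exact Subtype.ext (eq_of_pointLabel_eq w.2.1 w'.2.1
      (funext fun i => α.injective (congrFun h i)))
  unfold Jideal at *
  refine card_le_finrank_quotient hz ?_
  rintro _ (⟨m, h1, hm, rfl⟩ | ⟨d, hd, -, rfl⟩)
  · exact ⟨k, hpoly_isHomogeneous F k m,
      evalPts_hpoly_mem hk α (fun w i => pointLabel_lt w.2.1 i) hinj h1 hm⟩
  · refine ⟨d, esymm_isHomogeneous F d, evalPts_esymm_mem α hinj (fun w v hv => ?_) hd⟩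
    obtain ⟨i, rfl⟩ := w.2.2 v hv
    exact exists_pointLabel_eq

end LowerBound

section SetPartitions

variable {n k : ℕ}

/-- The word of an ordered set partition: the `i`-th letter is the index of the block of `i`. -/
def ospLetter (σ : OSP n k) (i : Fin n) : ℕ := (σ.2.2.2 i).choose

lemma mem_block_iff {σ : OSP n k} {i : Fin n} {p : Fin k} : i ∈ σ.1 p ↔ ospLetter σ i = p := by
  have h := (σ.2.2.2 i).choose_spec
  constructor
  · intro hp
    by_contra hne
    exact σ.2.2.1 _ _ (fun e => hne (congrArg Fin.val e)) i h hp
  · intro e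
    rwa [show (σ.2.2.2 i).choose = p from Fin.ext e] at h

lemma isWord_ospLetter (σ : OSP n k) : IsWord k (ospLetter σ) := by
  refine ⟨fun i => Fin.is_lt _, fun v hv => ?_⟩
  obtain ⟨i, hi⟩ := σ.2.1 ⟨v, hv⟩
  exact ⟨i, mem_block_iff.1 hi⟩

lemma ospLetter_injective : Function.Injective (ospLetter : OSP n k → Fin n → ℕ) := by
  intro σ τ h
  refine Subtype.ext (funext fun p => Finset.ext fun i => ?_)
  rw [mem_block_iff, mem_block_iff, h]

lemma exists_ospLetter_eq {w : Fin n → ℕ} (hw : IsWord k w) : ∃ σ : OSP n k, ospLetter σ = w := by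
  refine ⟨⟨fun p => Finset.univ.filter fun i => w i = p, fun p => ?_, fun p q hpq i hi hi' => ?_,
    fun i => ⟨⟨w i, hw.1 i⟩, by simp⟩⟩, ?_⟩
  · obtain ⟨i, hi⟩ := hw.2 p p.2
    exact ⟨i, by simpa using hi⟩
  · rw [Finset.mem_filter] at hi hi'
    exact hpq (Fin.ext (hi.2.symm.trans hi'.2))
  · ext i
    refine mem_block_iff (p := ⟨w i, hw.1 i⟩).1 ?_
    simp

/-- Ordered set partitions correspond to words. -/
def ospEquivWord (n k : ℕ) : OSP n k ≃ {w : Fin n → ℕ // IsWord k w} :=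
  Equiv.ofBijective (fun σ => ⟨ospLetter σ, isWord_ospLetter σ⟩)
    ⟨fun _ _ h => ospLetter_injective (congrArg Subtype.val h), fun w => by
      obtain ⟨σ, hσ⟩ := exists_ospLetter_eq w.2
      exact ⟨σ, Subtype.ext hσ⟩⟩

lemma ospLetter_ospMap_swap (σ : OSP n k) (a b : Fin n) :
    ospLetter (ospMap (Equiv.swap a b) σ) = ospLetter σ ∘ Equiv.swap a b := by
  ext i
  refine mem_block_iff (p := ⟨(ospLetter σ ∘ Equiv.swap a b) i, (isWord_ospLetter σ).1 _⟩).1 ?_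
  exact Finset.mem_image.2 ⟨Equiv.swap a b i, mem_block_iff.2 rfl, Equiv.swap_apply_self a b i⟩

lemma leftOf_iff {σ : OSP n k} {a b : Fin n} : leftOf σ a b ↔ ospLetter σ b < ospLetter σ a := by
  constructor
  · rintro ⟨p, q, hpq, hb, ha⟩
    rw [mem_block_iff.1 hb, mem_block_iff.1 ha]
    exact hpq
  · intro h
    exact ⟨⟨_, (isWord_ospLetter σ).1 b⟩, ⟨_, (isWord_ospLetter σ).1 a⟩, h,
      mem_block_iff.2 rfl, mem_block_iff.2 rfl⟩

lemma sameBlock_iff {σ : OSP n k} {a b : Fin n} :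
    sameBlock σ a b ↔ ospLetter σ a = ospLetter σ b := by
  constructor
  · rintro ⟨p, ha, hb⟩
    rw [mem_block_iff.1 ha, mem_block_iff.1 hb]
  · intro h
    exact ⟨⟨_, (isWord_ospLetter σ).1 a⟩, mem_block_iff.2 rfl, mem_block_iff.2 h.symm⟩

end SetPartitions

section Isomorphism

variable (F : Type*) [Field F] {n k : ℕ}

/-- The linear map sending an ordered set partition to its word polynomial. -/
def ospPoly (n k : ℕ) : (OSP n k →₀ F) →ₗ[F] MvPolynomial (Fin n) F :=
  Finsupp.linearCombination F fun σ => wordPoly F k (ospLetter σ)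

lemma demazure_ospPoly {i j : Fin n} (hij : (j : ℕ) = i + 1) (y : OSP n k →₀ F) :
    demazure i j (ospPoly F n k y) = ospPoly F n k (pibarOp F i j y) := by
  have key : ∀ σ : OSP n k, demazure i j (wordPoly F k (ospLetter σ)) =
      ospPoly F n k (pibarImg F i j σ) := by
    intro σ
    unfold pibarImg
    rw [leftOf_iff, sameBlock_iff]
    split_ifs with h1 h2
    · rw [demazure_wordPoly_of_gt F k hij h1, map_neg]
      simp [ospPoly]
    · rw [demazure_wordPoly_of_eq F k hij h2, map_zero]
    · rw [demazure_wordPoly_of_lt F k hij (by omega)]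
      simp [ospPoly, ospLetter_ospMap_swap]
  rw [pibarOp, Finsupp.sum, map_sum, ospPoly, Finsupp.linearCombination_apply, Finsupp.sum, map_sum]
  refine Finset.sum_congr rfl fun σ _ => ?_
  rw [map_smul, map_smul, key, ospPoly]

/-- The composite of `ospPoly` with the quotient map. -/
def ospQuot (n k : ℕ) : (OSP n k →₀ F) →ₗ[F] (MvPolynomial (Fin n) F ⧸ Jideal F n k) :=
  (Ideal.Quotient.mkₐ F (Jideal F n k)).toLinearMap ∘ₗ ospPoly F n k

lemma ospQuot_apply (y : OSP n k →₀ F) :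
    ospQuot F n k y = Ideal.Quotient.mk (Jideal F n k) (ospPoly F n k y) := rfl

lemma ospQuot_surjective (hk : 1 ≤ k) (hkn : k ≤ n) : Function.Surjective (ospQuot F n k) := by
  let mkL := (Ideal.Quotient.mkₐ F (Jideal F n k)).toLinearMap
  have h : ∀ f, f ∈ (LinearMap.range (ospQuot F n k)).comap mkL := by
    refine mem_of_mono_mem F fun b => mono_mem_span F hk hkn (fun f hf => ?_) (fun w hw => ?_) b
    · have : mkL f = 0 := Ideal.Quotient.eq_zero_iff_mem.2 hf
      rw [Submodule.mem_comap, this]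
      exact zero_mem _
    · obtain ⟨σ, rfl⟩ := exists_ospLetter_eq hw
      refine ⟨Finsupp.single σ 1, ?_⟩
      simp [ospQuot, ospPoly, mkL]
  intro s
  obtain ⟨f, rfl⟩ := Ideal.Quotient.mk_surjective s
  exact h f

lemma ospQuot_bijective (hk : 1 ≤ k) (hkn : k ≤ n) : Function.Bijective (ospQuot F n k) := by
  have hs := ospQuot_surjective F hk hkn
  have := finite_isWord n k
  have : Finite (OSP n k) := Finite.of_equiv _ (ospEquivWord n k).symm
  have := Fintype.ofFinite (OSP n k)
  have := Module.Finite.of_surjective _ hs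
  refine ⟨(LinearMap.injective_iff_surjective_of_finrank_eq_finrank
    (le_antisymm ?_ (LinearMap.finrank_le_finrank_of_surjective hs))).2 hs, hs⟩
  rw [Module.finrank_finsupp_self, ← Nat.card_eq_fintype_card, Nat.card_congr (ospEquivWord n k)]
  exact card_isWord_le_finrank F hk

variable {F}

lemma eq_demazure_of_pibarRel {t : ℕ} (ht : t + 1 < n) {f g : MvPolynomial (Fin n) F}
    (h : PibarRel F n t f g) : g = demazure ⟨t, Nat.lt_of_succ_lt ht⟩ ⟨t + 1, ht⟩ f := by
  unfold PibarRel Xv adjSwap at h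
  rw [dif_pos (Nat.lt_of_succ_lt ht), dif_pos ht, dif_pos ht] at h
  exact (demazure_eq (by simp) h).symm

end Isomorphism

/-- `S_{n,k}` and `F[OP_{n,k}]` are isomorphic as (ungraded)
`H_n(0)`-modules: there is an `F`-linear bijection `L : S_{n,k} → F[OP_{n,k}]`
intertwining the operators `π̄_i` on both sides. On the quotient `S_{n,k}` the operator
`π̄_i` is induced by the isobaric Demazure operator minus the identity, specified by the
relation `PibarRel` (the polynomial `g` with `PibarRel F n t f g` is the unique
`π̄`-image of `f`); on `F[OP_{n,k}]` it is the operator `pibarOp`. -/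
theorem Snk_iso_OSP (F : Type*) [Field F] (n k : ℕ) (hk : 1 ≤ k) (hkn : k ≤ n) :
    ∃ L : (MvPolynomial (Fin n) F ⧸ Jideal F n k) ≃ₗ[F] (OSP n k →₀ F),
      ∀ (t : ℕ) (ht : t + 1 < n) (f g : MvPolynomial (Fin n) F),
        PibarRel F n t f g →
          L (Ideal.Quotient.mk (Jideal F n k) g) =
            pibarOp F ⟨t, Nat.lt_of_succ_lt ht⟩ ⟨t + 1, ht⟩
              (L (Ideal.Quotient.mk (Jideal F n k) f)) := by
  let e := LinearEquiv.ofBijective (ospQuot F n k) (ospQuot_bijective F hk hkn)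
  refine ⟨e.symm, fun t ht f g h => ?_⟩
  rw [LinearEquiv.symm_apply_eq, eq_demazure_of_pibarRel ht h]
  obtain ⟨y, hy⟩ := e.surjective (Ideal.Quotient.mk (Jideal F n k) f)
  rw [← hy, LinearEquiv.symm_apply_apply]
  change _ = ospQuot F n k _
  rw [ospQuot_apply, ← demazure_ospPoly F rfl, Ideal.Quotient.eq, ← map_sub]
  refine demazure_mem_Jideal F hk rfl ?_
  rw [← Ideal.Quotient.eq, ← hy]
  rfl

end OSPHecke
end
end

section
/- Let F be a field, let k, i ≥ 1, let α_1,…,α_{k+i−1} ∈ F be pairwise distinct, and let z_1,…,z_i be pairwise distinct elements of the set {α_1,…,α_{k+i−1}}. Then ∑_{j=0}^{k} (−1)^j · h_{k−j}(z_1,…,z_i) · e_j(α_1,…,α_{k+i−1}) = 0, where h_m denotes the complete homogeneous symmetric function and e_m the elementary symmetric function of the indicated arguments. -/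
open scoped Classical
open MvPolynomial

noncomputable section

namespace OSPHecke

theorem mk_hval_eq_prod {F : Type*} [Field F] {n : ℕ} (v : Fin n → F) :
    PowerSeries.mk (hval F v) = ∏ j, PowerSeries.mk fun m => v j ^ m := by
  ext d
  rw [PowerSeries.coeff_mk, PowerSeries.coeff_prod, hval]
  refine Finset.sum_bij' (fun s _ => Multiset.toFinsupp s.1)
    (fun l hl => ⟨Finsupp.toMultiset l, ?_⟩) ?_ ?_ ?_ ?_ ?_
  · rw [Finset.mem_finsuppAntidiag'] at hl
    rw [Finsupp.card_toMultiset]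
    exact hl.1
  · rintro ⟨s, hs⟩ -
    rw [Finset.mem_finsuppAntidiag']
    refine ⟨?_, Finset.subset_univ _⟩
    have h := Finsupp.card_toMultiset (Multiset.toFinsupp s)
    rw [Multiset.toFinsupp_toMultiset, hs] at h
    exact h.symm
  · exact fun _ _ => Finset.mem_univ _
  · rintro ⟨s, hs⟩ -
    exact Subtype.ext (Multiset.toFinsupp_toMultiset s)
  · intro l hl
    simp
  · rintro ⟨s, hs⟩ -
    simp only [PowerSeries.coeff_mk, Multiset.toFinsupp_apply]
    exact Finset.prod_multiset_map_count s v |>.trans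
      (Finset.prod_subset (Finset.subset_univ _) fun x _ hx => by
        rw [Multiset.count_eq_zero.2 (by simpa using hx), pow_zero])

theorem mk_pow_mul_one_sub {F : Type*} [Field F] (c : F) :
    (PowerSeries.mk fun m => c ^ m) * (1 - PowerSeries.C c * PowerSeries.X) = 1 := by
  ext m
  rw [mul_sub, mul_one, mul_left_comm, map_sub, PowerSeries.coeff_C_mul]
  cases m with
  | zero => simp
  | succ m => simp [PowerSeries.coeff_succ_mul_X, PowerSeries.coeff_one, pow_succ']

theorem mk_hval_mul_prod {F : Type*} [Field F] {n : ℕ} (v : Fin n → F) :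
    PowerSeries.mk (hval F v) * ∏ j, (1 - PowerSeries.C (v j) * PowerSeries.X) = 1 := by
  rw [mk_hval_eq_prod, ← Finset.prod_mul_distrib]
  exact Finset.prod_eq_one fun j _ => mk_pow_mul_one_sub (v j)

theorem coeff_prod_one_sub {F : Type*} [Field F] {n : ℕ} (v : Fin n → F) (d : ℕ) :
    PowerSeries.coeff d (∏ j, (1 - PowerSeries.C (v j) * PowerSeries.X)) =
      (-1) ^ d * esymval F v d := by
  have h (t : Finset (Fin n)) : ∏ j ∈ t, -(PowerSeries.C (v j) * PowerSeries.X) =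
      PowerSeries.C ((-1) ^ t.card * ∏ j ∈ t, v j) * PowerSeries.X ^ t.card := by
    rw [Finset.prod_neg, Finset.prod_mul_distrib, Finset.prod_const]
    simp [mul_assoc]
  simp_rw [sub_eq_add_neg, Finset.prod_one_add, h, map_sum, PowerSeries.coeff_C_mul,
    PowerSeries.coeff_X_pow, mul_ite, mul_one, mul_zero]
  rw [← Finset.sum_filter, esymval, Finset.mul_sum]
  refine Finset.sum_congr ?_ fun t ht => ?_
  · ext t
    simp [Finset.mem_powersetCard, eq_comm]
  · rw [(Finset.mem_powersetCard.1 ht).2]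

theorem coeff_prod_one_sub_eq_zero {F ι : Type*} [Field F] (s : Finset ι) (v : ι → F) {d : ℕ}
    (hd : s.card < d) :
    PowerSeries.coeff d (∏ j ∈ s, (1 - PowerSeries.C (v j) * PowerSeries.X)) = 0 := by
  have h : ∏ j ∈ s, (1 - PowerSeries.C (v j) * PowerSeries.X) =
      ((∏ j ∈ s, (1 - Polynomial.C (v j) * Polynomial.X) : Polynomial F) : PowerSeries F) := by
    rw [← Polynomial.coeToPowerSeries.ringHom_apply, map_prod]
    simp
  rw [h, Polynomial.coeff_coe]
  refine Polynomial.coeff_eq_zero_of_natDegree_lt (lt_of_le_of_lt ?_ hd)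
  refine (Polynomial.natDegree_prod_le _ _).trans
    ((Finset.sum_le_card_nsmul _ _ 1 fun j _ => ?_).trans (by simp))
  compute_degree

/-- If `α_1, …, α_{k+i-1}` are pairwise distinct field elements and
`z_1, …, z_i` are pairwise distinct elements of `{α_1, …, α_{k+i-1}}`, then
`∑_{j=0}^{k} (-1)^j h_{k-j}(z_1,…,z_i) e_j(α_1,…,α_{k+i-1}) = 0`. -/
theorem h_e_vanishing (F : Type*) [Field F] (k i : ℕ) (hk : 1 ≤ k) (hi : 1 ≤ i)
    (a : Fin (k + i - 1) → F) (ha : Function.Injective a)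
    (z : Fin i → F) (hz : Function.Injective z)
    (hza : Set.range z ⊆ Set.range a) :
    ∑ j ∈ Finset.range (k + 1),
      (-1 : F) ^ j * hval F z (k - j) * esymval F a j = 0 := by
  choose σ hσ using fun j => hza (Set.mem_range_self j)
  have hσi : Function.Injective σ := fun x y hxy => hz (by rw [← hσ x, ← hσ y, hxy])
  set S : Finset (Fin (k + i - 1)) := Finset.univ.map ⟨σ, hσi⟩
  have hS : Sᶜ.card < k := by
    rw [Finset.card_compl, Finset.card_map, Finset.card_univ, Fintype.card_fin, Fintype.card_fin]
    omega
  have hprod : PowerSeries.mk (hval F z) * ∏ j, (1 - PowerSeries.C (a j) * PowerSeries.X) =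
      ∏ j ∈ Sᶜ, (1 - PowerSeries.C (a j) * PowerSeries.X) := by
    rw [← Finset.prod_mul_prod_compl S, ← mul_assoc, Finset.prod_map]
    simp only [Function.Embedding.coeFn_mk, hσ]
    rw [mk_hval_mul_prod, one_mul]
  have hcoeff := coeff_prod_one_sub_eq_zero Sᶜ a hS
  rw [← hprod, mul_comm, PowerSeries.coeff_mul,
    Finset.Nat.sum_antidiagonal_eq_sum_range_succ_mk] at hcoeff
  rw [← hcoeff]
  refine Finset.sum_congr rfl fun j _ => ?_
  rw [coeff_prod_one_sub, PowerSeries.coeff_mk]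
  ring

end OSPHecke
end
end

section
/- Let F be a field, let k ≤ n, let z_1,…,z_n ∈ F be pairwise distinct, and let α_1,…,α_k ∈ F be pairwise distinct elements with {α_1,…,α_k} ⊆ {z_1,…,z_n}. Then for every integer r with n−k < r ≤ n, one has ∑_{j=0}^{r} (−1)^j · e_{r−j}(z_1,…,z_n) · h_j(α_1,…,α_k) = 0, where e_m denotes the elementary symmetric function (with e_m = 0 for m > n) and h_m the complete homogeneous symmetric function of the indicated arguments. -/
open scoped Classical
open MvPolynomial

noncomputable section

namespace OSPHecke

/-- The elementary symmetric functions of `(v i)_{i ∈ s}` are the coefficients of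
`∏_{i ∈ s} (1 + v_i t)`. -/
theorem coeff_prod_one_add_C_mul_X {ι R : Type*} [CommRing R] (s : Finset ι) (v : ι → R)
    (d : ℕ) :
    PowerSeries.coeff d (∏ i ∈ s, (1 + PowerSeries.C (v i) * PowerSeries.X)) =
      ∑ t ∈ Finset.powersetCard d s, ∏ i ∈ t, v i := by
  rw [Finset.prod_one_add, map_sum, Finset.powersetCard_eq_filter, Finset.sum_filter]
  refine Finset.sum_congr rfl fun t _ => ?_
  rw [Finset.prod_mul_distrib, Finset.prod_const, ← map_prod, PowerSeries.coeff_C_mul,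
    PowerSeries.coeff_X_pow]
  simp [eq_comm]

theorem mk_hval {F : Type*} [Field F] {k : ℕ} (v : Fin k → F) :
    PowerSeries.mk (hval F v) = ∏ i, PowerSeries.mk fun m => v i ^ m := by
  ext d
  rw [PowerSeries.coeff_mk, PowerSeries.coeff_prod, hval]
  refine Finset.sum_bij' (fun s _ => (Sym.equivNatSum (Fin k) d s : Fin k →₀ ℕ))
    (fun l hl => (Sym.equivNatSum (Fin k) d).symm ⟨l, by
      simpa [Finsupp.sum_fintype] using hl⟩) ?_ ?_ ?_ ?_ ?_
  · intro s _
    have h := (Sym.equivNatSum (Fin k) d s).2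
    rw [Finsupp.sum_fintype _ _ (by simp)] at h
    exact Finset.mem_finsuppAntidiag.2 ⟨h, Finset.subset_univ _⟩
  · intros; exact Finset.mem_univ _
  · intro s _; simp
  · intro l hl; simp
  · intro s _
    simp only [PowerSeries.coeff_mk, Sym.coe_equivNatSum_apply_apply]
    rw [Finset.prod_multiset_map_count]
    refine Finset.prod_subset (Finset.subset_univ _) fun x _ hx => ?_
    have h : Multiset.count x (s : Multiset (Fin k)) = 0 :=
      Multiset.count_eq_zero_of_notMem (by simpa using hx)
    exact (congrArg (v x ^ ·) h).trans (pow_zero _)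

theorem hval_neg {F : Type*} [Field F] {k : ℕ} (v : Fin k → F) (d : ℕ) :
    hval F (fun i => -v i) d = (-1) ^ d * hval F v d := by
  rw [hval, hval, Finset.mul_sum]
  refine Finset.sum_congr rfl fun s _ => ?_
  have h : (s.1.map fun i => -v i).prod = (s.1.map fun i => -1 * v i).prod := by simp
  rw [h, Multiset.prod_map_mul, Multiset.map_const', Multiset.prod_replicate, s.2]

theorem one_add_C_mul_X_mul_mk_neg_pow {R : Type*} [CommRing R] (c : R) :
    (1 + PowerSeries.C c * PowerSeries.X) * PowerSeries.mk (fun m => (-c) ^ m) = 1 := by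
  ext (_ | m)
  · simp
  · rw [add_mul, one_mul, map_add, mul_assoc, PowerSeries.coeff_C_mul,
      PowerSeries.coeff_succ_X_mul]
    simp [pow_succ, PowerSeries.coeff_one]
    ring

/-- `∏ (1 + v_i t)` is inverse to the generating function of `(-1)^d h_d(v)`. -/
theorem prod_one_add_C_mul_X_mul_mk_hval {F : Type*} [Field F] {k : ℕ} (v : Fin k → F) :
    (∏ i, (1 + PowerSeries.C (v i) * PowerSeries.X)) *
      PowerSeries.mk (fun d => (-1) ^ d * hval F v d) = 1 := by
  have h : PowerSeries.mk (fun d => (-1) ^ d * hval F v d) =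
      PowerSeries.mk (hval F fun i => -v i) := by
    ext d
    simp [hval_neg]
  rw [h, mk_hval, ← Finset.prod_mul_distrib]
  exact Finset.prod_eq_one fun i _ => one_add_C_mul_X_mul_mk_neg_pow _

/-- If `z_1, …, z_n` are pairwise distinct field elements and
`α_1, …, α_k` are pairwise distinct elements of `{z_1, …, z_n}` (with `k ≤ n`), then for
every `r` with `n-k < r ≤ n`, `∑_{j=0}^{r} (-1)^j e_{r-j}(z_1,…,z_n) h_j(α_1,…,α_k) = 0`. -/
theorem e_h_vanishing (F : Type*) [Field F] (n k : ℕ) (hkn : k ≤ n)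
    (z : Fin n → F) (hz : Function.Injective z)
    (a : Fin k → F) (ha : Function.Injective a)
    (haz : Set.range a ⊆ Set.range z) :
    ∀ r : ℕ, n - k < r → r ≤ n →
      ∑ j ∈ Finset.range (r + 1),
        (-1 : F) ^ j * esymval F z (r - j) * hval F a j = 0 := by
  intro r hr _
  choose σ hσ using fun i => haz (Set.mem_range_self i)
  have hσi : Function.Injective σ := fun i j h => ha (by rw [← hσ i, ← hσ j, h])
  have hprod : (∏ i, (1 + PowerSeries.C (z i) * PowerSeries.X)) *
      PowerSeries.mk (fun d => (-1) ^ d * hval F a d) =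
      ∏ i ∈ (Finset.univ.image σ)ᶜ, (1 + PowerSeries.C (z i) * PowerSeries.X) := by
    rw [← Finset.prod_compl_mul_prod (Finset.univ.image σ), Finset.prod_image hσi.injOn]
    simp only [hσ]
    rw [mul_assoc, prod_one_add_C_mul_X_mul_mk_hval, mul_one]
  have hcoeff := congrArg (PowerSeries.coeff r) hprod
  rw [coeff_prod_one_add_C_mul_X, Finset.powersetCard_eq_empty.2 (by
      rwa [Finset.card_compl, Finset.card_image_of_injective _ hσi, Finset.card_univ,
        Fintype.card_fin, Fintype.card_fin]), Finset.sum_empty, mul_comm,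
    PowerSeries.coeff_mul, Finset.Nat.sum_antidiagonal_eq_sum_range_succ_mk] at hcoeff
  rw [← hcoeff]
  refine Finset.sum_congr rfl fun j _ => ?_
  rw [PowerSeries.coeff_mk, coeff_prod_one_add_C_mul_X, esymval]
  ring

end OSPHecke
end
end
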